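/- arXiv:1611.05658 — 5 statements merged into one kernel-verified Lean document; each statement's English description precedes it below -/
import Mathlib

section
/- Let g be a finite-dimensional semisimple real Lie algebra and let x ∈ g be real semisimple, i.e. the adjoint endomorphism ad x : g → g is diagonalizable over ℝ (the supremum over μ ∈ ℝ of the eigenspaces of ad x for eigenvalue μ is all of g). Let V be a finite-dimensional complex vector space that is a Lie module over the complexification ℂ ⊗_ℝ g, and let ψ_x : V → V be the endomorphism given by the action of the element 1 ⊗ x. Then ψ_x is diagonalizable with all eigenvalues real: the supremum over μ ∈ ℝ of the eigenspaces of ψ_x for the eigenvalue (μ : ℂ) is all of V. -/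
open TensorProduct

section

open Module LieModule

namespace Module.End

variable {K V : Type*} [Field K] [AddCommGroup V] [Module K V]

lemma mem_of_apply_sub_smul_mem_biSup_eigenspace {A : End K V} {s : Finset K} {a : K}
    (ha : a ∉ s) {v : V} (hv : A v - a • v ∈ ⨆ b ∈ s, A.eigenspace b) :
    v ∈ A.eigenspace a ⊔ ⨆ b ∈ s, A.eigenspace b := by
  suffices ∀ u ∈ ⨆ b ∈ s, A.eigenspace b, ∃ w ∈ ⨆ b ∈ s, A.eigenspace b, A w - a • w = u by
    obtain ⟨w, hw, hwv⟩ := this _ hv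
    refine Submodule.mem_sup.mpr ⟨v - w, ?_, w, hw, sub_add_cancel v w⟩
    rw [mem_eigenspace_iff, map_sub, smul_sub, sub_eq_sub_iff_sub_eq_sub, hwv]
  intro u hu
  induction hu using Submodule.iSup_induction' with
  | zero => exact ⟨0, zero_mem _, by simp⟩
  | add u₁ u₂ _ _ h₁ h₂ =>
    obtain ⟨w₁, hw₁, rfl⟩ := h₁
    obtain ⟨w₂, hw₂, rfl⟩ := h₂
    exact ⟨w₁ + w₂, add_mem hw₁ hw₂, by simp only [map_add, smul_add]; abel⟩
  | mem b u hu =>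
    by_cases hb : b ∈ s
    · rw [iSup_pos hb] at hu
      refine ⟨(b - a)⁻¹ • u, Submodule.smul_mem _ _ ?_, ?_⟩
      · exact (le_biSup (fun b ↦ A.eigenspace b) hb) hu
      · have : b - a ≠ 0 := sub_ne_zero.mpr fun h ↦ ha (h ▸ hb)
        rw [map_smul, mem_eigenspace_iff.mp hu, smul_comm a, ← smul_sub, ← sub_smul,
          inv_smul_smul₀ this]
    · rw [iSup_neg hb, Submodule.mem_bot] at hu
      exact ⟨0, zero_mem _, by simp [hu]⟩

/-- If two commuting operators are diagonalizable with eigenvalues in an additive subgroup `S`, then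
so is their sum. -/
lemma iSup_eigenspace_add_eq_top [FiniteDimensional K V] {A B : End K V} (hAB : Commute A B)
    (S : AddSubgroup K) (hA : ⨆ a : S, A.eigenspace (a : K) = ⊤)
    (hB : ⨆ b : S, B.eigenspace (b : K) = ⊤) :
    ⨆ c : S, (A + B).eigenspace (c : K) = ⊤ := by
  rw [eq_top_iff, ← hA]
  refine iSup_le fun a ↦ ?_
  have key : A.eigenspace (a : K) ≤ ⨆ b : K, A.eigenspace (a : K) ⊓ B.eigenspace b := by
    have hB' : ⨆ b : K, B.eigenspace b = ⊤ :=
      eq_top_iff.mpr (hB ▸ iSup_le fun b ↦ le_iSup (fun b : K ↦ B.eigenspace b) b)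
    have := Submodule.inf_iSup_genEigenspace (p := A.eigenspace (a : K)) (f := B)
      (fun x hx ↦ mapsTo_genEigenspace_of_comm hAB a 1 hx) 1
    change _ ⊓ (⨆ b : K, B.eigenspace b) = ⨆ b : K, _ ⊓ B.eigenspace b at this
    rw [hB', inf_top_eq] at this
    exact this.le
  refine key.trans (iSup_le fun b ↦ ?_)
  rintro v ⟨hva, hvb⟩
  by_cases hv : v = 0
  · simp [hv]
  have hb : b ∈ S := by
    by_contra hb
    refine hv (Submodule.disjoint_def.mp (B.eigenspaces_iSupIndep b) v hvb ?_)
    have : (⊤ : Submodule K V) ≤ ⨆ c, ⨆ (_ : c ≠ b), B.eigenspace c := by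
      rw [← hB]
      exact iSup_le fun c ↦ le_iSup₂_of_le (c : K) (fun h ↦ hb (h ▸ c.2)) le_rfl
    exact this trivial
  refine Submodule.mem_iSup_of_mem (a + ⟨b, hb⟩ : S) ?_
  rw [SetLike.mem_coe, mem_eigenspace_iff] at hva hvb
  simp [hva, hvb, add_smul]

end Module.End

namespace IsSl2Triple

variable {K L M : Type*} [Field K] [LieRing L] [LieAlgebra K L]
  [AddCommGroup M] [Module K M] [LieRingModule L M] [LieModule K L M]
  {h e f : L}

variable (K M) in
/-- The operator `4 f e + (h + 1)²`, an affine function of the Casimir operator of an `sl₂`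
triple. -/
def shiftedCasimir (_ : IsSl2Triple h e f) : End K M :=
  4 * (toEnd K L M f * toEnd K L M e) + (toEnd K L M h + 1) * (toEnd K L M h + 1)

variable (t : IsSl2Triple h e f)
include t

lemma toEnd_h_mul_toEnd_e :
    toEnd K L M h * toEnd K L M e = toEnd K L M e * toEnd K L M h + 2 * toEnd K L M e := by
  ext m
  simp [leibniz_lie h, t.lie_h_e_nsmul, two_mul, two_smul, add_comm]

lemma toEnd_h_mul_toEnd_f :
    toEnd K L M h * toEnd K L M f = toEnd K L M f * toEnd K L M h - 2 * toEnd K L M f := by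
  ext m
  simp [leibniz_lie h, t.lie_h_f_nsmul, two_mul, two_smul]
  abel

lemma toEnd_e_mul_toEnd_f :
    toEnd K L M e * toEnd K L M f = toEnd K L M f * toEnd K L M e + toEnd K L M h := by
  ext m
  simp [leibniz_lie e, t.lie_e_f, add_comm]

lemma commute_shiftedCasimir_toEnd_e : Commute (t.shiftedCasimir K M) (toEnd K L M e) := by
  rw [Commute, SemiconjBy, shiftedCasimir]
  linear_combination (norm := noncomm_ring)
    -4 * t.toEnd_e_mul_toEnd_f (K := K) (M := M) * toEnd K L M e
    + toEnd K L M h * t.toEnd_h_mul_toEnd_e (K := K) (M := M)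
    + t.toEnd_h_mul_toEnd_e (K := K) (M := M) * toEnd K L M h

lemma commute_shiftedCasimir_toEnd_h : Commute (t.shiftedCasimir K M) (toEnd K L M h) := by
  rw [Commute, SemiconjBy, shiftedCasimir]
  linear_combination (norm := noncomm_ring)
    -4 * t.toEnd_h_mul_toEnd_f (K := K) (M := M) * toEnd K L M e
    - 4 * toEnd K L M f * t.toEnd_h_mul_toEnd_e (K := K) (M := M)

lemma lie_h_toEnd_f_pow (n : ℕ) (m : M) :
    ⁅h, (toEnd K L M f ^ n) m⁆ =
      (toEnd K L M f ^ n) ⁅h, m⁆ - (2 * n : K) • (toEnd K L M f ^ n) m := by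
  induction n with
  | zero => simp
  | succ n ih =>
    simp only [pow_succ', End.mul_apply, toEnd_apply_apply]
    rw [leibniz_lie, ih, t.lie_lie_smul_f K]
    simp only [neg_lie, smul_lie, lie_sub, lie_smul]
    push_cast
    module

lemma lie_e_toEnd_f_pow_succ (n : ℕ) (m : M) :
    ⁅e, (toEnd K L M f ^ (n + 1)) m⁆ = (toEnd K L M f ^ (n + 1)) ⁅e, m⁆ +
      (n + 1 : K) • (toEnd K L M f ^ n) (⁅h, m⁆ - (n : K) • m) := by
  induction n with
  | zero => simp [leibniz_lie e, t.lie_e_f, add_comm]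
  | succ n ih =>
    rw [pow_succ' _ (n + 1), End.mul_apply, toEnd_apply_apply, leibniz_lie, ih, t.lie_e_f,
      t.lie_h_toEnd_f_pow]
    simp only [map_sub, map_smul, lie_add, lie_smul, lie_sub, End.mul_apply, toEnd_apply_apply,
      pow_succ' _ n]
    push_cast
    module

lemma shiftedCasimir_apply_of_lie_e_eq_zero {m : M} {μ : K} (he : ⁅e, m⁆ = 0)
    (hh : ⁅h, m⁆ = μ • m) : t.shiftedCasimir K M m = (μ + 1) ^ 2 • m := by
  have h4 : (4 : End K M) 0 = 0 := map_zero _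
  simp only [shiftedCasimir, LinearMap.add_apply, End.mul_apply, toEnd_apply_apply, he, lie_zero,
    End.one_apply, hh, lie_add, lie_smul, h4]
  module

/-- On a generalized eigenspace of the Casimir operator, all primitive vectors have the same
weight. -/
lemma exists_nat_lie_h_eq_smul_of_lie_e_eq_zero [CharZero K]
    (hf : IsNilpotent (toEnd K L M f)) (c : K) :
    ∃ k : ℕ, ∀ m ∈ (t.shiftedCasimir K M).maxGenEigenspace c, ⁅e, m⁆ = 0 →
      ⁅h, m⁆ = (k : K) • m := by
  have eq_zero {μ : K} (hμ : (μ + 1) ^ 2 ≠ c) {m : M}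
      (hm : m ∈ (t.shiftedCasimir K M).maxGenEigenspace c) (he : ⁅e, m⁆ = 0)
      (hh : ⁅h, m⁆ = μ • m) : m = 0 := by
    refine Submodule.disjoint_def.mp (End.disjoint_genEigenspace _ hμ 1 ⊤) m ?_ hm
    exact End.mem_eigenspace_iff.mpr (t.shiftedCasimir_apply_of_lie_e_eq_zero he hh)
  obtain ⟨k, hk⟩ : ∃ k : ℕ, ∀ j : ℕ, j ≠ k → ((j : K) + 1) ^ 2 ≠ c := by
    by_cases hc : ∃ k : ℕ, ((k : K) + 1) ^ 2 = c
    · obtain ⟨k, rfl⟩ := hc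
      refine ⟨k, fun j hj h ↦ hj ?_⟩
      have : (j + 1) ^ 2 = (k + 1) ^ 2 := by exact_mod_cast h
      simpa using this
    · exact ⟨0, fun j _ h ↦ hc ⟨j, h⟩⟩
  refine ⟨k, fun m hm he ↦ ?_⟩
  obtain ⟨N, hN⟩ := hf
  suffices ∀ n : ℕ, ∀ m ∈ (t.shiftedCasimir K M).maxGenEigenspace c, ⁅e, m⁆ = 0 →
      (toEnd K L M f ^ n) m = 0 → (n ≤ k → m = 0) ∧ ⁅h, m⁆ = (k : K) • m from
    (this N m hm he (by simp [hN])).2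
  intro n
  induction n with
  | zero =>
    intro m _ _ hm
    obtain rfl : m = 0 := by simpa using hm
    simp
  | succ n ih =>
    intro m hm he hfm
    have sub_mem' (a : K) : ⁅h, m⁆ - a • m ∈ (t.shiftedCasimir K M).maxGenEigenspace c :=
      sub_mem (End.mapsTo_maxGenEigenspace_of_comm t.commute_shiftedCasimir_toEnd_h c hm)
        (Submodule.smul_mem _ _ hm)
    have lie_sub' (a : K) : ⁅e, ⁅h, m⁆ - a • m⁆ = 0 := by
      rw [lie_sub, lie_smul, he, leibniz_lie, he, ← lie_skew, t.lie_h_e_smul K]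
      simp [he]
    obtain ⟨h₁, h₂⟩ := ih _ (sub_mem' n) (lie_sub' n) (by
      have := t.lie_e_toEnd_f_pow_succ (K := K) n m
      rw [hfm, he, lie_zero, map_zero, zero_add, eq_comm, smul_eq_zero] at this
      exact this.resolve_left (Nat.cast_add_one_ne_zero n))
    rcases lt_trichotomy n k with hn | rfl | hn
    · have : m = 0 := eq_zero (hk n hn.ne) hm he (sub_eq_zero.mp (h₁ hn.le))
      simp [this]
    · exact ⟨by simp, sub_eq_zero.mp (h₁ le_rfl)⟩
    · refine ⟨by lia, sub_eq_zero.mp (eq_zero (hk n hn.ne') (sub_mem' k) (lie_sub' k) ?_)⟩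
      simp only [lie_sub, lie_smul, smul_sub] at h₂ ⊢
      rw [sub_eq_sub_iff_add_eq_add] at h₂ ⊢
      rw [smul_comm (n : K) (k : K) m, add_comm _ (_ • ⁅h, m⁆), h₂]

/-- The element `h` of an `sl₂` triple acts diagonalizably, with integer eigenvalues, on any
finite-dimensional representation on which `e` and `f` act nilpotently. -/
theorem iSup_eigenspace_intCast_eq_top [CharZero K] [IsAlgClosed K] [FiniteDimensional K M]
    (he : IsNilpotent (toEnd K L M e)) (hf : IsNilpotent (toEnd K L M f)) :
    ⨆ n : ℤ, (toEnd K L M h).eigenspace (n : K) = ⊤ := by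
  classical
  rw [eq_top_iff, ← End.iSup_maxGenEigenspace_eq_top (t.shiftedCasimir K M)]
  refine iSup_le fun c m hm ↦ ?_
  obtain ⟨k, hk⟩ := t.exists_nat_lie_h_eq_smul_of_lie_e_eq_zero hf c
  obtain ⟨N, hN⟩ := he
  suffices ∀ (i : ℕ), ∀ m ∈ (t.shiftedCasimir K M).maxGenEigenspace c,
      (toEnd K L M e ^ i) m = 0 →
      m ∈ ⨆ b ∈ (Finset.range i).image (fun j : ℕ ↦ ((k - 2 * j : ℤ) : K)),
        (toEnd K L M h).eigenspace b by
    refine SetLike.le_def.mp (iSup₂_le fun b hb ↦ ?_) (this N m hm (by simp [hN]))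
    obtain ⟨j, -, rfl⟩ := Finset.mem_image.mp hb
    exact le_iSup (fun n : ℤ ↦ (toEnd K L M h).eigenspace (n : K)) _
  have lie_h_sub (i : ℕ) (m : M) : (toEnd K L M e ^ i) (⁅h, m⁆ - ((k - 2 * i : ℤ) : K) • m) =
      ⁅h, (toEnd K L M e ^ i) m⁆ - (k : K) • (toEnd K L M e ^ i) m := by
    induction i generalizing m with
    | zero => simp
    | succ i ih =>
      simp only [pow_succ, End.mul_apply]
      rw [← ih]
      congr 1
      simp only [toEnd_apply_apply, lie_sub, lie_smul]
      rw [leibniz_lie h, t.lie_h_e_smul K, smul_lie]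
      push_cast
      module
  intro i
  induction i with
  | zero => intro m _ hm; simpa using hm
  | succ i ih =>
    intro m hm him
    rw [Finset.range_add_one, Finset.image_insert, Finset.iSup_insert]
    refine End.mem_of_apply_sub_smul_mem_biSup_eigenspace ?_ (ih _ ?_ ?_)
    · simp only [Finset.mem_image, Finset.mem_range, Int.cast_inj]
      lia
    · exact sub_mem (End.mapsTo_maxGenEigenspace_of_comm t.commute_shiftedCasimir_toEnd_h c hm)
        (Submodule.smul_mem _ _ hm)
    · rw [toEnd_apply_apply, lie_h_sub, sub_eq_zero]
      refine hk _ ?_ ?_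
      · exact End.mapsTo_maxGenEigenspace_of_comm
          (t.commute_shiftedCasimir_toEnd_e.pow_right i) c hm
      · rwa [pow_succ'] at him

end IsSl2Triple

namespace Module.End

variable {K V : Type*} [Field K] [AddCommGroup V] [Module K V]

lemma disjoint_ker_range_of_iSup_eigenspace_eq_top {f : End K V}
    (hf : ⨆ μ : K, f.eigenspace μ = ⊤) :
    Disjoint (LinearMap.ker f) (LinearMap.range f) := by
  rw [← f.eigenspace_zero]
  refine (f.eigenspaces_iSupIndep 0).mono_right ?_
  rw [← Submodule.map_top, ← hf, Submodule.map_iSup]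
  refine iSup_le fun μ ↦ ?_
  rintro - ⟨v, hv, rfl⟩
  have hv : f v = μ • v := mem_eigenspace_iff.mp hv
  rw [hv]
  by_cases hμ : μ = 0
  · simp [hμ]
  · exact Submodule.smul_mem _ _ (Submodule.mem_iSup_of_mem μ
      (Submodule.mem_iSup_of_mem hμ (mem_eigenspace_iff.mpr hv)))

lemma apply_eq_zero_of_pow_apply_eq_zero {f : End K V}
    (hf : ⨆ μ : K, f.eigenspace μ = ⊤) {n : ℕ} {v : V} (hv : (f ^ n) v = 0) : f v = 0 := by
  induction n with
  | zero => simp_all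
  | succ n ih =>
    cases n with
    | zero => simpa using hv
    | succ n =>
      have hdis := disjoint_ker_range_of_iSup_eigenspace_eq_top hf
      refine ih (Submodule.disjoint_def.mp hdis _ ?_ ?_)
      · simpa [pow_succ'] using hv
      · simp [pow_succ']

end Module.End

namespace LinearMap.BilinForm

lemma Nondegenerate.baseChange {K : Type*} (A : Type*) {M : Type*} [Field K] [Field A]
    [Algebra K A] [AddCommGroup M] [Module K M] [FiniteDimensional K M]
    {B : LinearMap.BilinForm K M} (hB : B.Nondegenerate) : (B.baseChange A).Nondegenerate := by
  classical
  let b := Module.finBasis K M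
  have key : BilinForm.toMatrix (b.baseChange A) (B.baseChange A) =
      (BilinForm.toMatrix b B).map (algebraMap K A) := by
    ext i j
    simp [BilinForm.toMatrix_apply, Algebra.algebraMap_eq_smul_one]
  rw [← nondegenerate_toMatrix_iff (b.baseChange A), key,
    Matrix.nondegenerate_iff_det_ne_zero, ← (algebraMap K A).mapMatrix_apply, ← RingHom.map_det,
    ne_eq, FaithfulSMul.algebraMap_eq_zero_iff, ← ne_eq, ← Matrix.nondegenerate_iff_det_ne_zero,
    nondegenerate_toMatrix_iff]
  exact hB

end LinearMap.BilinForm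

namespace LieAlgebra

lemma IsKilling.baseChange (K A L : Type*) [Field K] [Field A] [Algebra K A]
    [LieRing L] [LieAlgebra K L] [FiniteDimensional K L] [IsKilling K L] :
    IsKilling A (A ⊗[K] L) where
  killingCompl_top_eq_bot := by
    have h := LinearMap.BilinForm.Nondegenerate.baseChange A (killingForm_nondegenerate K L)
    rw [killingForm, ← traceForm_baseChange, ← killingForm] at h
    rw [← LieSubmodule.toSubmodule_inj]
    exact (LieIdeal.coe_killingCompl_top A (A ⊗[K] L)).trans
      (LinearMap.separatingLeft_iff_ker_eq_bot.mp h.1)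

variable {K L : Type*} [Field K] [LieRing L] [LieAlgebra K L]

lemma exists_isCartanSubalgebra_mem_of_iSup_eigenspace_ad_eq_top [Infinite K]
    [FiniteDimensional K L] {x : L} (hx : ⨆ μ : K, (ad K L x).eigenspace μ = ⊤) :
    ∃ H : LieSubalgebra K L, H.IsCartanSubalgebra ∧ x ∈ H := by
  let C := LieSubalgebra.engel K x
  have lie_eq_zero {y : L} (hy : y ∈ C) : ⁅x, y⁆ = 0 := by
    obtain ⟨n, hn⟩ := LieSubalgebra.mem_engel_iff K x y |>.mp hy
    exact End.apply_eq_zero_of_pow_apply_eq_zero hx hn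
  have hxC : x ∈ C := LieSubalgebra.self_mem_engel K x
  obtain ⟨z, hz⟩ := LieAlgebra.exists_isCartanSubalgebra_engel K C
  set H₀ := LieSubalgebra.engel K z
  have hxH : (⟨x, hxC⟩ : C) ∈ H₀ := by
    rw [← hz.self_normalizing, LieSubalgebra.mem_normalizer_iff']
    intro y _
    convert H₀.zero_mem
    ext
    change ⁅(y : L), x⁆ = 0
    rw [← lie_skew, lie_eq_zero y.2, neg_zero]
  refine ⟨H₀.map C.incl, ⟨?_, ?_⟩, ⟨⟨x, hxC⟩, hxH, rfl⟩⟩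
  · have := hz.nilpotent
    exact (LieEquiv.nilpotent_iff_equiv_nilpotent
      (H₀.equivMapOfInjective C.incl Subtype.val_injective)).mp inferInstance
  · refine le_antisymm (fun y hy ↦ ?_) (LieSubalgebra.le_normalizer _)
    rw [LieSubalgebra.mem_normalizer_iff'] at hy
    have hyC : y ∈ C := by
      obtain ⟨w, -, hw⟩ := hy x ⟨⟨x, hxC⟩, hxH, rfl⟩
      obtain ⟨n, hn⟩ := LieSubalgebra.mem_engel_iff K x _ |>.mp w.2
      refine LieSubalgebra.mem_engel_iff K x y |>.mpr ⟨n + 1, ?_⟩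
      change (w : L) = _ at hw
      simpa [pow_succ, hw] using hn
    refine ⟨⟨y, hyC⟩, ?_, rfl⟩
    change (⟨y, hyC⟩ : C) ∈ H₀
    rw [← hz.self_normalizing, LieSubalgebra.mem_normalizer_iff']
    intro w hw
    obtain ⟨u, hu, huw⟩ := hy w ⟨w, hw, rfl⟩
    have : ⁅w, (⟨y, hyC⟩ : C)⁆ = u := Subtype.ext huw.symm
    exact this ▸ hu

lemma iSup_eigenspace_ad_one_tmul_eq_top {A : Type*} [Field A] [Algebra K A] {x : L}
    (hx : ⨆ μ : K, (ad K L x).eigenspace μ = ⊤) :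
    ⨆ μ : K, (ad A (A ⊗[K] L) (1 ⊗ₜ x)).eigenspace (algebraMap K A μ) = ⊤ := by
  refine Submodule.eq_top_iff'.mpr fun z ↦ ?_
  induction z with
  | zero => exact zero_mem _
  | add z w hz hw => exact add_mem hz hw
  | tmul a y =>
    have hy : y ∈ ⨆ μ : K, (ad K L x).eigenspace μ := hx ▸ Submodule.mem_top
    induction hy using Submodule.iSup_induction' with
    | zero => simp
    | add y w _ _ hy hw => rw [TensorProduct.tmul_add]; exact add_mem hy hw
    | mem μ y hy =>
      refine Submodule.mem_iSup_of_mem μ (End.mem_eigenspace_iff.mpr ?_)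
      have hy : ⁅x, y⁆ = μ • y := End.mem_eigenspace_iff.mp hy
      simp [ExtendScalars.bracket_tmul, hy, TensorProduct.tmul_smul]

end LieAlgebra

namespace LieAlgebra.IsKilling

lemma iSup_eigenspace_intCast_toEnd_coroot_eq_top {K L V : Type*} [Field K] [CharZero K]
    [IsAlgClosed K] [LieRing L] [LieAlgebra K L] [FiniteDimensional K L] [IsKilling K L]
    {H : LieSubalgebra K L} [H.IsCartanSubalgebra]
    [AddCommGroup V] [Module K V] [FiniteDimensional K V] [LieRingModule L V] [LieModule K L V]
    {α : Weight K H L} (hα : α.IsNonZero) :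
    ⨆ n : ℤ, (toEnd K L V (coroot α : H)).eigenspace (n : K) = ⊤ := by
  obtain ⟨h, e, f, t, he, hf⟩ := exists_isSl2Triple_of_weight_isNonZero hα
  have hα0 : (α : H → K) ≠ 0 := hα
  rw [← t.h_eq_coroot hα he hf]
  exact t.iSup_eigenspace_intCast_eq_top (isNilpotent_toEnd_of_mem_rootSpace V H hα0 he)
    (isNilpotent_toEnd_of_mem_rootSpace V H (neg_ne_zero.mpr hα0) hf)

variable {L V : Type*} [LieRing L] [LieAlgebra ℂ L] [FiniteDimensional ℂ L] [IsKilling ℂ L]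
  {H : LieSubalgebra ℂ L} [H.IsCartanSubalgebra]

section

variable [AddCommGroup V] [Module ℂ V] [FiniteDimensional ℂ V] [LieRingModule L V]
  [LieModule ℂ L V]

variable (V H) in
/-- The real subspace of a Cartan subalgebra formed by the elements on which every root is real
and which act on `V` diagonalizably with real eigenvalues. -/
def realDiagonalizable : Submodule ℝ H where
  carrier := {y | (∀ α : Weight ℂ H L, (α y).im = 0) ∧
    ⨆ μ : ℝ, (toEnd ℂ L V y).eigenspace (μ : ℂ) = ⊤}
  zero_mem' := by
    refine ⟨by simp, Submodule.eq_top_iff'.mpr fun v ↦ Submodule.mem_iSup_of_mem 0 ?_⟩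
    simp
  add_mem' := by
    rintro y z ⟨hy, hy'⟩ ⟨hz, hz'⟩
    have key (f : End ℂ V) : ⨆ μ : ℝ, f.eigenspace (μ : ℂ) =
        ⨆ c : Complex.ofRealHom.toAddMonoidHom.range, f.eigenspace (c : ℂ) :=
      Complex.ofRealHom.toAddMonoidHom.rangeRestrict_surjective.iSup_comp
        (g := fun c : Complex.ofRealHom.toAddMonoidHom.range ↦ f.eigenspace (c : ℂ))
    rw [key] at hy' hz'
    refine ⟨fun α ↦ ?_, ?_⟩
    · have := map_add α.toLinear y z
      simp_all
    · have hyz : Commute (toEnd ℂ L V y) (toEnd ℂ L V z) := by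
        have h0 : ⁅(y : L), (z : L)⁆ = 0 := by
          rw [← LieSubalgebra.coe_bracket, trivial_lie_zero, ZeroMemClass.coe_zero]
        ext v
        change ⁅(y : L), ⁅(z : L), v⁆⁆ = ⁅(z : L), ⁅(y : L), v⁆⁆
        rw [leibniz_lie, h0, zero_lie, zero_add]
      rw [key, AddMemClass.coe_add, map_add]
      exact End.iSup_eigenspace_add_eq_top hyz _ hy' hz'
  smul_mem' := by
    rintro r y ⟨hy, hy'⟩
    refine ⟨fun α ↦ ?_, eq_top_iff.mpr (hy'.ge.trans (iSup_le fun μ v hv ↦ ?_))⟩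
    · have h : α (r • y) = r • α y := map_smul α.toLinear (r : ℂ) y
      rw [h, Complex.smul_im, hy, smul_zero]
    · refine Submodule.mem_iSup_of_mem (r * μ) ?_
      have hv : ⁅(y : L), v⁆ = (μ : ℂ) • v := End.mem_eigenspace_iff.mp hv
      rw [End.mem_eigenspace_iff]
      change ⁅((r : ℂ) • (y : L)), v⁆ = _
      rw [smul_lie, hv, smul_smul, Complex.ofReal_mul]

lemma coroot_mem_realDiagonalizable (α : Weight ℂ H L) (hα : α.IsNonZero) :
    coroot α ∈ realDiagonalizable V H := by
  refine ⟨fun β ↦ by rw [apply_coroot_eq_cast α β]; exact Complex.intCast_im _,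
    eq_top_iff.mpr ?_⟩
  rw [← iSup_eigenspace_intCast_toEnd_coroot_eq_top (V := V) hα]
  exact iSup_le fun n ↦ le_iSup_of_le (n : ℝ) (by simp)

lemma exists_add_I_smul_of_realDiagonalizable (y : H) :
    ∃ a ∈ realDiagonalizable V H, ∃ b ∈ realDiagonalizable V H, y = a + Complex.I • b := by
  have hy : y ∈ Submodule.span ℂ (Set.range (rootSystem H).coroot) := by
    simp
  induction hy using Submodule.span_induction with
  | mem y hy =>
    obtain ⟨α, rfl⟩ := hy
    have hα : (α : Weight ℂ H L).IsNonZero := by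
      simpa only [LieSubalgebra.root, Finset.mem_filter_univ] using α.2
    exact ⟨coroot α, coroot_mem_realDiagonalizable _ hα, 0, zero_mem _, by simp⟩
  | zero => exact ⟨0, zero_mem _, 0, zero_mem _, by simp⟩
  | add y z _ _ hy hz =>
    obtain ⟨a, ha, b, hb, rfl⟩ := hy
    obtain ⟨a', ha', b', hb', rfl⟩ := hz
    exact ⟨a + a', add_mem ha ha', b + b', add_mem hb hb', by module⟩
  | smul c y _ hy =>
    obtain ⟨a, ha, b, hb, rfl⟩ := hy
    refine ⟨c.re • a - c.im • b, sub_mem (Submodule.smul_mem _ _ ha) (Submodule.smul_mem _ _ hb),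
      c.re • b + c.im • a, add_mem (Submodule.smul_mem _ _ hb) (Submodule.smul_mem _ _ ha), ?_⟩
    have hcI : c * Complex.I = c.re * Complex.I - c.im := by
      apply Complex.ext <;> simp
    rw [smul_add, smul_smul, hcI]
    conv_lhs => enter [1]; rw [← Complex.re_add_im c]
    simp only [← Complex.coe_smul]
    module

lemma iSup_eigenspace_ofReal_toEnd_eq_top {y : H} (hy : ∀ α : Weight ℂ H L, (α y).im = 0) :
    ⨆ μ : ℝ, (toEnd ℂ L V y).eigenspace (μ : ℂ) = ⊤ := by
  obtain ⟨a, ha, b, hb, rfl⟩ := exists_add_I_smul_of_realDiagonalizable (V := V) y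
  suffices b = 0 by simpa [this] using ha.2
  rw [← Submodule.mem_bot ℂ, ← iInf_ker_weight_eq_bot (H := H), Submodule.mem_iInf]
  intro α
  have h := hy α
  have h1 : α (a + Complex.I • b) = α a + Complex.I * α b := by simp
  have ha := ha.1 α
  have hb := hb.1 α
  simp only [h1, Complex.add_im, Complex.mul_im, Complex.I_re, Complex.I_im, ha] at h
  exact Complex.ext (by simpa using h) hb

end

lemma weight_im_eq_zero_of_iSup_eigenspace_ad {y : H}
    (hy : ⨆ μ : ℝ, (ad ℂ L y).eigenspace (μ : ℂ) = ⊤) (α : Weight ℂ H L) : (α y).im = 0 := by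
  obtain ⟨v, hv, hv0⟩ := α.exists_ne_zero
  by_contra h
  refine hv0 (Submodule.disjoint_def.mp ((ad ℂ L (y : L)).eigenspaces_iSupIndep (α y)) v
    (End.mem_eigenspace_iff.mpr (lie_eq_smul_of_mem_rootSpace hv y)) ?_)
  refine SetLike.le_def.mp (iSup_le fun μ ↦ ?_) (hy.ge (Submodule.mem_top (x := v)))
  refine le_iSup₂_of_le (μ : ℂ) (fun hμ ↦ h ?_) le_rfl
  simp [← hμ]

end LieAlgebra.IsKilling

end

/-- Let `g` be a finite-dimensional semisimple real Lie algebra and `x ∈ g` real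
semisimple (i.e. `ad x` is diagonalizable over `ℝ`). Then for every finite-dimensional complex
Lie module `V` over the complexification `ℂ ⊗[ℝ] g`, the endomorphism of `V` given by the action
of `1 ⊗ₜ x` is diagonalizable with all eigenvalues real. -/
theorem toEnd_baseChange_diagonalizable_real_eigenvalues
    {g : Type*} [LieRing g] [LieAlgebra ℝ g] [Module.Finite ℝ g]
    [LieAlgebra.IsSemisimple ℝ g]
    (x : g)
    (hx : ⨆ μ : ℝ, Module.End.eigenspace (LieAlgebra.ad ℝ g x) μ = ⊤)
    (V : Type*) [AddCommGroup V] [Module ℂ V] [Module.Finite ℂ V]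
    [LieRingModule (ℂ ⊗[ℝ] g) V] [LieModule ℂ (ℂ ⊗[ℝ] g) V] :
    ⨆ μ : ℝ, Module.End.eigenspace
        (LieModule.toEnd ℂ (ℂ ⊗[ℝ] g) V ((1 : ℂ) ⊗ₜ[ℝ] x)) (μ : ℂ) = ⊤ := by
  have := LieAlgebra.IsKilling.baseChange ℝ ℂ g
  have hx' := LieAlgebra.iSup_eigenspace_ad_one_tmul_eq_top (A := ℂ) hx
  obtain ⟨H, _, hxH⟩ := LieAlgebra.exists_isCartanSubalgebra_mem_of_iSup_eigenspace_ad_eq_top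
    (eq_top_iff.mpr (hx'.ge.trans (iSup_le fun μ ↦ le_iSup _ (μ : ℂ))))
  exact LieAlgebra.IsKilling.iSup_eigenspace_ofReal_toEnd_eq_top (y := (⟨_, hxH⟩ : H))
    (LieAlgebra.IsKilling.weight_im_eq_zero_of_iSup_eigenspace_ad hx')
end

section
/- Let M and N be real skew-symmetric n×n matrices, and let iM and iN denote the complex Hermitian n×n matrices obtained by multiplying the entrywise complexifications of M and N by the imaginary unit i. Then N lies in convexHull{g M gᵀ : g ∈ O(n)} if and only if, for every p = 1, …, n, the sum of the p largest eigenvalues of iN is at most the sum of the p largest eigenvalues of iM. -/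
open Matrix

/-- The sum of the `p` largest values of `f` (with multiplicity): the supremum of all sums of
`f` over `p`-element subsets of the index set. -/
noncomputable def sumLargest {ι : Type*} [Fintype ι] (f : ι → ℝ) (p : ℕ) : ℝ :=
  sSup {x : ℝ | ∃ s : Finset ι, s.card = p ∧ x = ∑ i ∈ s, f i}

/-- If `M` is a real skew-symmetric matrix, then `i M` (the entrywise complexification of `M`
multiplied by the imaginary unit) is Hermitian. -/
lemma isHermitian_I_smul_of_skew {n : ℕ} {M : Matrix (Fin n) (Fin n) ℝ}
    (hM : Mᵀ = -M) :
    (Complex.I • M.map (Complex.ofReal)).IsHermitian := by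
  ext i j
  have h : M j i = -M i j := by
    have := congrFun (congrFun hM i) j
    simpa [Matrix.transpose_apply, Matrix.neg_apply] using this
  simp [Matrix.conjTranspose_apply, Matrix.map_apply, Matrix.smul_apply, h, Complex.ext_iff,
    mul_comm]

section SumLargest

variable {ι : Type*} [Fintype ι]

lemma bddAbove_sums (f : ι → ℝ) (p : ℕ) :
    BddAbove {x : ℝ | ∃ s : Finset ι, s.card = p ∧ x = ∑ i ∈ s, f i} :=
  ((Set.finite_range fun s : Finset ι ↦ ∑ i ∈ s, f i).subset
    (by rintro _ ⟨s, -, rfl⟩; exact ⟨s, rfl⟩)).bddAbove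

lemma sum_le_sumLargest (f : ι → ℝ) (s : Finset ι) :
    ∑ i ∈ s, f i ≤ sumLargest f s.card :=
  le_csSup (bddAbove_sums f _) ⟨s, rfl, rfl⟩

lemma exists_sumLargest_eq (f : ι → ℝ) {p : ℕ} (hp : p ≤ Fintype.card ι) :
    ∃ s : Finset ι, s.card = p ∧ sumLargest f p = ∑ i ∈ s, f i := by
  have hne : {x : ℝ | ∃ s : Finset ι, s.card = p ∧ x = ∑ i ∈ s, f i}.Nonempty := by
    obtain ⟨s, -, hs⟩ := Finset.exists_subset_card_eq (s := Finset.univ) (n := p) (by simpa)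
    exact ⟨_, s, hs, rfl⟩
  have hfin : {x : ℝ | ∃ s : Finset ι, s.card = p ∧ x = ∑ i ∈ s, f i}.Finite :=
    (Set.finite_range fun s : Finset ι ↦ ∑ i ∈ s, f i).subset
      (by rintro _ ⟨s, -, rfl⟩; exact ⟨s, rfl⟩)
  exact hne.csSup_mem hfin

lemma weighted_sum_le_sumLargest (f t : ι → ℝ) {p : ℕ} (hp : p ≤ Fintype.card ι)
    (h0 : ∀ i, 0 ≤ t i) (h1 : ∀ i, t i ≤ 1) (ht : ∑ i, t i = p) :
    ∑ i, t i * f i ≤ sumLargest f p := by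
  classical
  obtain ⟨s, hs, hmax⟩ := exists_sumLargest_eq f hp
  rw [hmax]
  rcases s.eq_empty_or_nonempty with rfl | hne
  · obtain rfl : p = 0 := by simpa using hs.symm
    have : ∀ i, t i = 0 := by
      simpa [Finset.sum_eq_zero_iff_of_nonneg, h0] using ht
    simp [this]
  obtain ⟨i₀, hi₀, hmin⟩ := Finset.exists_min_image s f hne
  have hout : ∀ j ∉ s, f j ≤ f i₀ := by
    intro j hj
    have hj' : j ∉ s.erase i₀ := fun h ↦ hj (Finset.mem_of_mem_erase h)
    have hcard : (insert j (s.erase i₀)).card = p := by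
      rw [Finset.card_insert_of_notMem hj', Finset.card_erase_add_one hi₀, hs]
    have hle := sum_le_sumLargest f (insert j (s.erase i₀))
    rw [hcard, hmax, Finset.sum_insert hj', ← Finset.add_sum_erase s f hi₀] at hle
    linarith
  have hind : ∑ i, (if i ∈ s then (1 : ℝ) else 0) = p := by simp [hs]
  have hindf : ∑ i, (if i ∈ s then (1 : ℝ) else 0) * f i = ∑ i ∈ s, f i := by simp
  have hterm : ∑ i, (t i - if i ∈ s then (1 : ℝ) else 0) * (f i - f i₀) ≤ 0 := by
    refine Finset.sum_nonpos fun i _ ↦ ?_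
    by_cases hi : i ∈ s
    · simp only [hi, if_true]
      exact mul_nonpos_of_nonpos_of_nonneg (by linarith [h1 i]) (by linarith [hmin i hi])
    · simp only [hi, if_false]
      exact mul_nonpos_of_nonneg_of_nonpos (by linarith [h0 i]) (by linarith [hout i hi])
  have hexp : ∑ i, (t i - if i ∈ s then (1 : ℝ) else 0) * (f i - f i₀) =
      ∑ i, t i * f i - ∑ i, (if i ∈ s then (1 : ℝ) else 0) * f i
        - (∑ i, t i - ∑ i, if i ∈ s then (1 : ℝ) else 0) * f i₀ := by
    rw [← Finset.sum_sub_distrib, ← Finset.sum_sub_distrib, Finset.sum_mul,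
      ← Finset.sum_sub_distrib]
    exact Finset.sum_congr rfl fun i _ ↦ by ring
  rw [hexp, hind, hindf, ht] at hterm
  linarith

end SumLargest

section KyFan

open scoped ComplexOrder

variable {n κ : Type*} [Fintype n] [DecidableEq n] [Fintype κ] [DecidableEq κ]

/-- The relaxation of the set of orthogonal projections of rank `p` used in Ky Fan's variational
principle. -/
structure IsFractionalProjection (p : ℕ) (P : Matrix n n ℂ) : Prop where
  posSemidef : P.PosSemidef
  one_sub : (1 - P).PosSemidef
  trace_eq : P.trace = p

/-- `Z` is unitarily diagonalized, with real eigenvalues `d`. -/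
def HasSpectralForm (Z : Matrix n n ℂ) (d : κ → ℝ) : Prop :=
  ∃ U : Matrix n κ ℂ, U * Uᴴ = 1 ∧ Uᴴ * U = 1 ∧ Z = U * diagonal (fun k ↦ (d k : ℂ)) * Uᴴ

lemma Matrix.IsHermitian.hasSpectralForm {Z : Matrix n n ℂ} (hZ : Z.IsHermitian) :
    HasSpectralForm Z hZ.eigenvalues := by
  refine ⟨hZ.eigenvectorUnitary, ?_, ?_, ?_⟩
  · exact Unitary.mul_star_self_of_mem hZ.eigenvectorUnitary.2
  · exact Unitary.star_mul_self_of_mem hZ.eigenvectorUnitary.2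
  · conv_lhs => rw [hZ.spectral_theorem]
    rw [Unitary.conjStarAlgAut_apply]
    rfl

lemma IsFractionalProjection.conj {p : ℕ} {P : Matrix n n ℂ} (hP : IsFractionalProjection p P)
    {U : Matrix n κ ℂ} (hU : U * Uᴴ = 1) (hU' : Uᴴ * U = 1) :
    IsFractionalProjection p (Uᴴ * P * U) where
  posSemidef := hP.posSemidef.conjTranspose_mul_mul_same U
  one_sub := by
    have h := hP.one_sub.conjTranspose_mul_mul_same U
    rwa [Matrix.mul_sub, Matrix.sub_mul, Matrix.mul_one, hU'] at h
  trace_eq := by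
    rw [Matrix.trace_mul_comm, ← Matrix.mul_assoc, hU, Matrix.one_mul, hP.trace_eq]

lemma isFractionalProjection_diagonal (s : Finset n) :
    IsFractionalProjection s.card (diagonal fun i ↦ if i ∈ s then (1 : ℂ) else 0) where
  posSemidef := PosSemidef.diagonal fun i ↦ by dsimp; split_ifs <;> simp
  one_sub := by
    rw [← diagonal_one, diagonal_sub]
    exact PosSemidef.diagonal fun i ↦ by dsimp; split_ifs <;> simp
  trace_eq := by simp [trace_diagonal]

lemma HasSpectralForm.trace_mul_re_le {Z P : Matrix n n ℂ} {d : κ → ℝ}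
    (hZ : HasSpectralForm Z d) {p : ℕ} (hp : p ≤ Fintype.card κ)
    (hP : IsFractionalProjection p P) : (P * Z).trace.re ≤ sumLargest d p := by
  obtain ⟨U, hU, hU', rfl⟩ := hZ
  have hQ := hP.conj hU hU'
  have htr : (P * (U * diagonal (fun k ↦ (d k : ℂ)) * Uᴴ)).trace =
      ((Uᴴ * P * U) * diagonal (fun k ↦ (d k : ℂ))).trace := by
    rw [← Matrix.mul_assoc, Matrix.trace_mul_comm]
    simp only [Matrix.mul_assoc]
  generalize Uᴴ * P * U = Q at hQ htr
  have hre : (P * (U * diagonal (fun k ↦ (d k : ℂ)) * Uᴴ)).trace.re =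
      ∑ k, (Q k k).re * d k := by
    rw [htr]
    simp [Matrix.trace, Matrix.mul_diagonal]
  rw [hre]
  refine weighted_sum_le_sumLargest d _ hp (fun k ↦ ?_) (fun k ↦ ?_) ?_
  · exact (Complex.le_def.1 (hQ.posSemidef.diag_nonneg (i := k))).1
  · have := (Complex.le_def.1 (hQ.one_sub.diag_nonneg (i := k))).1
    simpa using this
  · simpa [Matrix.trace] using congrArg Complex.re hQ.trace_eq

lemma HasSpectralForm.exists_trace_mul_re_eq {Z : Matrix n n ℂ} {d : κ → ℝ}
    (hZ : HasSpectralForm Z d) (s : Finset κ) :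
    ∃ P, IsFractionalProjection s.card P ∧ (P * Z).trace.re = ∑ k ∈ s, d k := by
  obtain ⟨U, hU, hU', rfl⟩ := hZ
  refine ⟨U * (diagonal fun i ↦ if i ∈ s then (1 : ℂ) else 0) * Uᴴ, ?_, ?_⟩
  · simpa using (isFractionalProjection_diagonal s).conj (U := Uᴴ) (by simpa) (by simpa)
  · rw [Matrix.trace_mul_comm,
      show U * diagonal (fun k ↦ (d k : ℂ)) * Uᴴ *
          (U * (diagonal fun i ↦ if i ∈ s then (1 : ℂ) else 0) * Uᴴ) =
        U * (diagonal (fun k ↦ (d k : ℂ)) * (Uᴴ * U) *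
          (diagonal fun i ↦ if i ∈ s then (1 : ℂ) else 0)) * Uᴴ by simp only [Matrix.mul_assoc],
      hU', Matrix.mul_one, diagonal_mul_diagonal, Matrix.trace_mul_comm, ← Matrix.mul_assoc, hU',
      Matrix.one_mul]
    simp [Matrix.trace]

end KyFan

section Majorization

lemma sum_mul_ge_of_partial_sums_nonneg : ∀ {m : ℕ} (c x : Fin m → ℝ), Antitone c →
    (∀ p : ℕ, p ≤ m → 0 ≤ ∑ j with j.val < p, x j) → ∀ d : ℝ, (∀ j, d ≤ c j) →
      d * ∑ j, x j ≤ ∑ j, c j * x j := by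
  intro m
  induction m with
  | zero => simp
  | succ m ih =>
    intro c x hc hx d hd
    have hpart : ∀ p : ℕ, p ≤ m → 0 ≤ ∑ j : Fin m with j.val < p, x j.castSucc := by
      intro p hp
      have h := hx p (by omega)
      rw [Finset.sum_filter, Fin.sum_univ_castSucc] at h
      rw [Finset.sum_filter]
      simpa [show ¬ m < p by omega] using h
    have h1 := ih (fun j ↦ c j.castSucc) (fun j ↦ x j.castSucc)
      (hc.comp_monotone (Fin.strictMono_castSucc.monotone)) hpart (c (Fin.last m))
      (fun j ↦ hc (Fin.le_last _))
    have h2 : 0 ≤ ∑ j, x j := by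
      have h := hx (m + 1) le_rfl
      rwa [Finset.filter_true_of_mem (fun j _ ↦ j.2)] at h
    rw [Fin.sum_univ_castSucc] at h2 ⊢
    rw [Fin.sum_univ_castSucc]
    nlinarith [hd (Fin.last m)]

lemma sum_le_sum_initial {m : ℕ} {b : Fin m → ℝ} (hb : Antitone b) (hb0 : ∀ j, 0 ≤ b j)
    (s : Finset (Fin m)) {p : ℕ} (hs : s.card ≤ p) :
    ∑ j ∈ s, b j ≤ ∑ j with j.val < p, b j := by
  have hle : ∀ {k : ℕ} (f : Fin k ↪o Fin m) (i : Fin k), i.val ≤ (f i).val := by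
    intro k f i
    obtain ⟨i, hi⟩ := i
    induction i with
    | zero => simp
    | succ i ih =>
      have h1 := ih (by omega)
      have h2 : f ⟨i, by omega⟩ < f ⟨i + 1, hi⟩ := f.strictMono (by simp)
      have h3 : (f ⟨i, by omega⟩).val < (f ⟨i + 1, hi⟩).val := h2
      dsimp at h1 ⊢
      omega
  have hsm : s.card ≤ m := by simpa using s.card_le_univ
  calc ∑ j ∈ s, b j = ∑ i : Fin s.card, b (s.orderEmbOfFin rfl i) := by
        conv_lhs => rw [← Finset.image_orderEmbOfFin_univ s rfl]
        rw [Finset.sum_image fun _ _ _ _ h ↦ (s.orderEmbOfFin rfl).injective h]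
    _ ≤ ∑ i : Fin s.card, b (Fin.castLE hsm i) :=
        Finset.sum_le_sum fun i _ ↦ hb (Fin.le_def.2 (hle _ i))
    _ = ∑ j ∈ Finset.univ.image (Fin.castLE hsm), b j := by
        rw [Finset.sum_image fun _ _ _ _ h ↦ Fin.castLE_injective hsm h]
    _ ≤ ∑ j with j.val < p, b j := by
        refine Finset.sum_le_sum_of_subset_of_nonneg ?_ fun j _ _ ↦ hb0 j
        intro j hj
        obtain ⟨i, -, rfl⟩ := Finset.mem_image.1 hj
        have := i.2
        simp
        omega

/-- A vector weakly majorized by a nonnegative vector `b` is a convex combination of the signed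
permutations of `b`. -/
lemma mem_convexHull_signed_perm {m : ℕ} {a b : Fin m → ℝ} (ha : ∀ j, 0 ≤ a j)
    (hb : ∀ j, 0 ≤ b j)
    (hab : ∀ s : Finset (Fin m), ∃ t : Finset (Fin m), t.card ≤ s.card ∧
      ∑ j ∈ s, a j ≤ ∑ j ∈ t, b j) :
    a ∈ convexHull ℝ (Set.range fun q : (Fin m → Bool) × Equiv.Perm (Fin m) ↦
      fun j ↦ (if q.1 j then (-1 : ℝ) else 1) * b (q.2 j)) := by
  by_contra hmem
  obtain ⟨f, u, hf, hu⟩ := geometric_hahn_banach_closed_point (convex_convexHull ℝ _)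
    ((Set.finite_range _).isClosed_convexHull ℝ) hmem
  set c : Fin m → ℝ := fun i ↦ f fun j ↦ if i = j then 1 else 0
  have hfc : ∀ x, f x = ∑ i, x i * c i := fun x ↦ by
    simpa using LinearMap.pi_apply_eq_sum_univ f.toLinearMap x
  set σ := Tuple.sort fun i ↦ -|c i|
  set τ := Tuple.sort fun i ↦ -b i
  have hσ : Antitone fun i ↦ |c (σ i)| := fun i j h ↦ by
    simpa [σ] using Tuple.monotone_sort (fun i ↦ -|c i|) h
  have hτ : Antitone fun i ↦ b (τ i) := fun i j h ↦ by
    simpa [τ] using Tuple.monotone_sort (fun i ↦ -b i) h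
  have hkey : ∑ i, |c i| * a i ≤ ∑ i, |c i| * b (τ (σ.symm i)) := by
    rw [← Equiv.sum_comp σ, ← Equiv.sum_comp σ fun i ↦ |c i| * b (τ (σ.symm i))]
    simp only [Equiv.symm_apply_apply]
    have h := sum_mul_ge_of_partial_sums_nonneg (fun i ↦ |c (σ i)|)
      (fun i ↦ b (τ i) - a (σ i)) hσ ?_ 0 fun _ ↦ abs_nonneg _
    · simp only [mul_sub, Finset.sum_sub_distrib] at h
      linarith
    intro p hp
    rw [Finset.sum_sub_distrib, sub_nonneg]
    obtain ⟨t, ht, hle⟩ := hab ((Finset.univ.filter fun j : Fin m ↦ j.val < p).map σ.toEmbedding)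
    rw [Finset.sum_map] at hle
    refine hle.trans ?_
    have hcard : (t.map τ.symm.toEmbedding).card ≤ p := by
      rw [Finset.card_map]
      refine ht.trans ?_
      rw [Finset.card_map, Fin.card_filter_val_lt]
      exact min_le_right _ _
    have := sum_le_sum_initial hτ (fun j ↦ hb _) _ hcard
    simpa using this
  have hle : f a ≤ ∑ i, |c i| * a i := by
    rw [hfc]
    refine Finset.sum_le_sum fun i _ ↦ ?_
    rw [mul_comm]
    exact mul_le_mul_of_nonneg_right (le_abs_self _) (ha i)
  have hlt := hf _ (subset_convexHull ℝ _ ⟨(fun i ↦ decide (c i < 0), σ.symm.trans τ), rfl⟩)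
  rw [hfc] at hlt
  have heq : ∑ i, |c i| * b (τ (σ.symm i)) =
      ∑ i, (if decide (c i < 0) then (-1 : ℝ) else 1) * b ((σ.symm.trans τ) i) * c i := by
    refine Finset.sum_congr rfl fun i _ ↦ ?_
    simp only [decide_eq_true_eq, Equiv.trans_apply]
    split_ifs with h
    · rw [abs_of_neg h]; ring
    · rw [abs_of_nonneg (not_lt.1 h)]; ring
  linarith

end Majorization

section NormalForm

open scoped RealInnerProductSpace
open Module

variable {E : Type*} [NormedAddCommGroup E] [InnerProductSpace ℝ E] [FiniteDimensional ℝ E]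

lemma exists_rotation_pair (T : E →ₗ[ℝ] E) (hT : ∀ x y, ⟪T x, y⟫ = -⟪x, T y⟫)
    (h2 : 2 ≤ finrank ℝ E) :
    ∃ (x y : E) (θ : ℝ), 0 ≤ θ ∧ ⟪x, x⟫ = 1 ∧ ⟪y, y⟫ = 1 ∧ ⟪x, y⟫ = 0 ∧
      T x = -θ • y ∧ T y = θ • x := by
  have hself : ∀ x, ⟪x, T x⟫ = 0 := fun x ↦ by
    have := hT x x
    rw [real_inner_comm] at this
    linarith
  have hS : (T ∘ₗ T).IsSymmetric := fun x y ↦ by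
    simp [hT]
  set b := hS.eigenvectorBasis rfl
  by_cases h : ∃ i, T (b i) ≠ 0
  · obtain ⟨i, hi⟩ := h
    have hpos : 0 < ‖T (b i)‖ := norm_pos_iff.2 hi
    have hxx : ⟪b i, b i⟫ = 1 := by simp
    have hTT : T (T (b i)) = hS.eigenvalues rfl i • b i := hS.apply_eigenvectorBasis rfl i
    have hμ : hS.eigenvalues rfl i = -(‖T (b i)‖ * ‖T (b i)‖) := by
      have h1 := hT (b i) (T (b i))
      rw [hTT, inner_smul_right, hxx, real_inner_self_eq_norm_mul_norm] at h1
      linarith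
    refine ⟨b i, -(‖T (b i)‖⁻¹ • T (b i)), ‖T (b i)‖, norm_nonneg _, hxx, ?_, ?_, ?_, ?_⟩
    · rw [inner_neg_neg, real_inner_smul_left, real_inner_smul_right,
        real_inner_self_eq_norm_mul_norm]
      field_simp
    · rw [inner_neg_right, real_inner_smul_right, hself]
      simp
    · rw [smul_neg, neg_smul, neg_neg, smul_smul, mul_inv_cancel₀ hpos.ne', one_smul]
    · rw [map_neg, map_smul, hTT, hμ, smul_smul, ← neg_smul]
      congr 1
      field_simp
  · push Not at h
    refine ⟨b ⟨0, by omega⟩, b ⟨1, by omega⟩, 0, le_rfl, by simp, by simp, ?_, by simp [h],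
      by simp [h]⟩
    exact b.orthonormal.2 (by simp)

lemma exists_rotation_family (T : E →ₗ[ℝ] E) (hT : ∀ x y, ⟪T x, y⟫ = -⟪x, T y⟫) (m : ℕ)
    (hm : 2 * m ≤ finrank ℝ E) :
    ∃ (x y : Fin m → E) (θ : Fin m → ℝ), Orthonormal ℝ (Sum.elim x y) ∧
      ∀ i, 0 ≤ θ i ∧ T (x i) = -θ i • y i ∧ T (y i) = θ i • x i := by
  induction m with
  | zero =>
    refine ⟨Fin.elim0, Fin.elim0, Fin.elim0, ⟨?_, ?_⟩, fun i ↦ i.elim0⟩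
    · rintro (i | i) <;> exact i.elim0
    · rintro (i | i) <;> exact i.elim0
  | succ m ih =>
    obtain ⟨x, y, θ, ho, hθ⟩ := ih (by omega)
    set V : Submodule ℝ E := Submodule.span ℝ (Set.range (Sum.elim x y)) with hV
    have hxV : ∀ i, x i ∈ V := fun i ↦ Submodule.subset_span ⟨Sum.inl i, rfl⟩
    have hyV : ∀ i, y i ∈ V := fun i ↦ Submodule.subset_span ⟨Sum.inr i, rfl⟩
    have hTV : ∀ v ∈ V, T v ∈ V := by
      intro v hv
      induction hv using Submodule.span_induction with
      | mem v hv =>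
        obtain ⟨i | i, rfl⟩ := hv
        · simpa [(hθ i).2.1] using V.smul_mem _ (hyV i)
        · simpa [(hθ i).2.2] using V.smul_mem _ (hxV i)
      | zero => simp
      | add v w _ _ hv hw => simpa using V.add_mem hv hw
      | smul c v _ hv => simpa using V.smul_mem c hv
    have hTW : ∀ w ∈ Vᗮ, T w ∈ Vᗮ := by
      intro w hw v hv
      have := hT v w
      rw [hw _ (hTV v hv)] at this
      linarith
    have hdim : 2 ≤ finrank ℝ Vᗮ := by
      have h1 := V.finrank_add_finrank_orthogonal
      have h2 : finrank ℝ V = 2 * m := by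
        rw [hV, finrank_span_eq_card ho.linearIndependent]
        simp
        omega
      omega
    obtain ⟨x₀, y₀, θ₀, hθ₀, hxx, hyy, hxy, hTx, hTy⟩ :=
      exists_rotation_pair (T.restrict hTW) (fun v w ↦ hT v w) hdim
    replace hTx : T x₀ = -θ₀ • (y₀ : E) := congrArg Subtype.val hTx
    replace hTy : T y₀ = θ₀ • (x₀ : E) := congrArg Subtype.val hTy
    replace hxx : ⟪(x₀ : E), x₀⟫ = 1 := hxx
    replace hyy : ⟪(y₀ : E), y₀⟫ = 1 := hyy
    replace hxy : ⟪(x₀ : E), y₀⟫ = 0 := hxy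
    have hxn : ‖(x₀ : E)‖ = 1 := by rw [norm_eq_sqrt_real_inner, hxx, Real.sqrt_one]
    have hyn : ‖(y₀ : E)‖ = 1 := by rw [norm_eq_sqrt_real_inner, hyy, Real.sqrt_one]
    have hperp : ∀ (w : Vᗮ) (v : E), v ∈ V → ⟪v, (w : E)⟫ = 0 ∧ ⟪(w : E), v⟫ = 0 :=
      fun w v hv ↦ ⟨w.2 v hv, by rw [real_inner_comm]; exact w.2 v hv⟩
    rw [orthonormal_iff_ite] at ho
    refine ⟨Fin.cons x₀ x, Fin.cons y₀ y, Fin.cons θ₀ θ, ?_, ?_⟩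
    · rw [orthonormal_iff_ite]
      have hyx : ⟪(y₀ : E), x₀⟫ = 0 := by rw [real_inner_comm]; exact hxy
      have h1 := fun i j ↦ ho (Sum.inl i) (Sum.inl j)
      have h2 := fun i j ↦ ho (Sum.inl i) (Sum.inr j)
      have h3 := fun i j ↦ ho (Sum.inr i) (Sum.inl j)
      have h4 := fun i j ↦ ho (Sum.inr i) (Sum.inr j)
      simp only [Sum.elim_inl, Sum.elim_inr, Sum.inl.injEq, Sum.inr.injEq, reduceCtorEq,
        if_false] at h1 h2 h3 h4
      rintro (i | i) (j | j) <;> refine Fin.cases ?_ (fun i ↦ ?_) i <;>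
        refine Fin.cases ?_ (fun j ↦ ?_) j <;>
        simp [-Submodule.coe_inner, hxn, hyn, hxy, hyx, hperp _ _ (hxV _), hperp _ _ (hyV _),
          h1, h2, h3, h4, Fin.succ_ne_zero, (Fin.succ_ne_zero _).symm]
    · intro i
      refine Fin.cases ⟨hθ₀, hTx, hTy⟩ (fun i ↦ ?_) i
      simpa using hθ i

/-- The real canonical form of a skew-symmetric matrix: `2 × 2` rotation generators scaled by the
entries of `θ`, followed by an `r × r` zero block. -/
def skewCanonical {m : ℕ} (r : ℕ) (θ : Fin m → ℝ) :
    Matrix ((Fin m ⊕ Fin m) ⊕ Fin r) ((Fin m ⊕ Fin m) ⊕ Fin r) ℝ :=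
  fromBlocks (fromBlocks 0 (diagonal θ) (-diagonal θ) 0) 0 0 0

lemma exists_skewCanonical {n : ℕ} (M : Matrix (Fin n) (Fin n) ℝ) (hM : Mᵀ = -M) :
    ∃ (U : Matrix (Fin n) ((Fin (n / 2) ⊕ Fin (n / 2)) ⊕ Fin (n % 2)) ℝ)
      (θ : Fin (n / 2) → ℝ), (∀ i, 0 ≤ θ i) ∧ U * Uᵀ = 1 ∧ Uᵀ * U = 1 ∧
        M = U * skewCanonical (n % 2) θ * Uᵀ := by
  set T := toEuclideanLin M with hTdef
  have hT : ∀ x y, ⟪T x, y⟫ = -⟪x, T y⟫ := by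
    intro x y
    have h : T.adjoint = -T := by
      rw [hTdef, ← Matrix.toEuclideanLin_conjTranspose_eq_adjoint,
        conjTranspose_eq_transpose_of_trivial,
        hM, map_neg]
    rw [← LinearMap.adjoint_inner_right, h]
    simp
  obtain ⟨x, y, θ, ho, hθ⟩ := exists_rotation_family T hT (n / 2) (by simp; omega)
  obtain ⟨b, hb⟩ := Orthonormal.exists_orthonormalBasis_extension_of_card_eq
    (ι := (Fin (n / 2) ⊕ Fin (n / 2)) ⊕ Fin (n % 2)) (𝕜 := ℝ) (E := EuclideanSpace ℝ (Fin n))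
    (v := Sum.elim (Sum.elim x y) 0) (s := Set.range Sum.inl) (by simp; omega) (by
      rw [orthonormal_iff_ite] at ho ⊢
      rintro ⟨_, i, rfl⟩ ⟨_, j, rfl⟩
      simpa [Subtype.ext_iff] using ho i j)
  have hbx : ∀ i, b (.inl (.inl i)) = x i := fun i ↦ hb _ ⟨_, rfl⟩
  have hby : ∀ i, b (.inl (.inr i)) = y i := fun i ↦ hb _ ⟨_, rfl⟩
  have hbo := orthonormal_iff_ite.1 b.orthonormal
  have hb0 : ∀ i, T (b (.inr i)) = 0 := by
    intro i
    refine InnerProductSpace.ext_inner_left_basis b.toBasis fun j ↦ ?_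
    rw [inner_zero_right, OrthonormalBasis.coe_toBasis, ← neg_eq_zero, ← hT]
    rcases j with (j | j) | j
    · rw [hbx, (hθ j).2.1, ← hby, inner_smul_left, hbo]
      simp
    · rw [hby, (hθ j).2.2, ← hbx, inner_smul_left, hbo]
      simp
    · obtain rfl : i = j := by
        have := i.2; have := j.2; ext; omega
      have := hT (b (.inr i)) (b (.inr i))
      rw [real_inner_comm] at this ⊢
      linarith
  set U : Matrix (Fin n) ((Fin (n / 2) ⊕ Fin (n / 2)) ⊕ Fin (n % 2)) ℝ :=
    of fun i k ↦ b k i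
  have hUU : Uᵀ * U = 1 := by
    ext k l
    rw [Matrix.one_apply, ← hbo k l, mul_apply]
    simp [U, PiLp.inner_apply, mul_comm]
  have hUU' : U * Uᵀ = 1 :=
    (Matrix.mul_eq_one_comm_of_card_eq _ _ _ (by simp; omega)).1 hUU
  have hMU : M * U = U * skewCanonical (n % 2) θ := by
    ext i k
    have hTk : (M * U) i k = T (b k) i := by
      simp [T, U, mul_apply, toLpLin_apply, mulVec, dotProduct]
    rw [hTk, mul_apply, Fintype.sum_sum_type, Fintype.sum_sum_type]
    rcases k with (k | k) | k
    · rw [hbx, (hθ k).2.1]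
      simp [skewCanonical, U, diagonal_apply, hby, mul_comm]
    · rw [hby, (hθ k).2.2]
      simp [skewCanonical, U, diagonal_apply, hbx, mul_comm]
    · rw [hb0]
      simp [skewCanonical]
  refine ⟨U, θ, fun i ↦ (hθ i).1, hUU', hUU, ?_⟩
  rw [← hMU, Matrix.mul_assoc, hUU', Matrix.mul_one]

lemma skewCanonical_add {m : ℕ} (r : ℕ) (θ η : Fin m → ℝ) :
    skewCanonical r (θ + η) = skewCanonical r θ + skewCanonical r η := by
  simp [skewCanonical, fromBlocks_add, add_comm]

lemma skewCanonical_smul {m : ℕ} (r : ℕ) (c : ℝ) (θ : Fin m → ℝ) :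
    skewCanonical r (c • θ) = c • skewCanonical r θ := by
  have h : diagonal (c • θ) = c • diagonal θ := (diagonal_smul c θ)
  simp only [skewCanonical, fromBlocks_smul, h, smul_neg, smul_zero]

lemma exists_orthogonal_conj_skewCanonical {m : ℕ} (r : ℕ) (ε : Fin m → Bool)
    (σ : Equiv.Perm (Fin m)) (b : Fin m → ℝ) :
    ∃ Q : Matrix ((Fin m ⊕ Fin m) ⊕ Fin r) ((Fin m ⊕ Fin m) ⊕ Fin r) ℝ,
      Q * Qᵀ = 1 ∧ skewCanonical r (fun j ↦ (if ε j then (-1 : ℝ) else 1) * b (σ j)) =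
        Q * skewCanonical r b * Qᵀ := by
  set s : Fin m → ℝ := fun j ↦ if ε j then -1 else 1
  have hs : ∀ j, s j * s j = 1 := fun j ↦ by
    simp only [s]
    split_ifs <;> norm_num
  set A : Matrix (Fin m) (Fin m) ℝ := (diagonal s).submatrix id σ.symm
  set B : Matrix (Fin m) (Fin m) ℝ := (1 : Matrix (Fin m) (Fin m) ℝ).submatrix id σ.symm
  have hconj : ∀ (d₁ d₂ b : Fin m → ℝ),
      (diagonal d₁).submatrix id σ.symm * diagonal b * ((diagonal d₂).submatrix id σ.symm)ᵀ =
        diagonal fun j ↦ d₁ j * b (σ j) * d₂ j := by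
    intro d₁ d₂ b
    have hb : diagonal b = (diagonal (b ∘ σ)).submatrix σ.symm σ.symm := by
      rw [submatrix_diagonal_equiv]
      congr 1
      ext j
      simp
    rw [hb, transpose_submatrix, submatrix_mul_equiv, submatrix_mul_equiv, diagonal_transpose,
      diagonal_mul_diagonal, diagonal_mul_diagonal, submatrix_id_id]
    rfl
  have h1 : A * Aᵀ = 1 := by
    simp [A, hs]
  have h2 : B * Bᵀ = 1 := by
    simp [B]
  have h3 : A * diagonal b * Bᵀ = diagonal fun j ↦ s j * b (σ j) := by
    simpa [A, B] using hconj s 1 b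
  have h4 : B * diagonal b * Aᵀ = diagonal fun j ↦ s j * b (σ j) := by
    simpa [A, B, mul_comm] using hconj 1 s b
  have hQ : fromBlocks (fromBlocks A 0 0 B) 0 0 (1 : Matrix (Fin r) (Fin r) ℝ) *
      (fromBlocks (fromBlocks A 0 0 B) 0 0 (1 : Matrix (Fin r) (Fin r) ℝ))ᵀ = 1 := by
    simp [fromBlocks_transpose, fromBlocks_multiply, h1, h2]
  refine ⟨_, hQ, ?_⟩
  rw [show (fun j ↦ (if ε j then (-1 : ℝ) else 1) * b (σ j)) = fun j ↦ s j * b (σ j) from rfl]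
  simp [skewCanonical, fromBlocks_transpose, fromBlocks_multiply, h3, h4, -diagonal_neg]

end NormalForm

section Complexification

open Complex in
lemma hasSpectralForm_skewCanonical {m : ℕ} (r : ℕ) (θ : Fin m → ℝ) :
    HasSpectralForm (I • (skewCanonical r θ).map ofReal)
      (Sum.elim (Sum.elim θ (-θ)) (0 : Fin r → ℝ)) := by
  set c : ℂ := (((√2)⁻¹ : ℝ) : ℂ)
  have hc : c * c + c * c = 1 := by
    rw [← ofReal_mul, ← ofReal_add, ← mul_inv, Real.mul_self_sqrt (by norm_num)]
    norm_num
  have hstar : star c = c := conj_ofReal _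
  set W : Matrix ((Fin m ⊕ Fin m) ⊕ Fin r) ((Fin m ⊕ Fin m) ⊕ Fin r) ℂ :=
    fromBlocks (fromBlocks (c • 1) (c • 1) ((-I * c) • 1) ((I * c) • 1)) 0 0 1
  have hI : I * c * (I * c) = -(c * c) := by
    linear_combination c * c * I_mul_I
  have hWW : W * Wᴴ = 1 := by
    simp [W, fromBlocks_conjTranspose, fromBlocks_multiply, hstar, smul_smul, ← add_smul, hI,
      hc]
  refine ⟨W, hWW, mul_eq_one_comm.1 hWW, ?_⟩
  have hZW : (I • (skewCanonical r θ).map ofReal) * W =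
      W * diagonal fun k ↦ ((Sum.elim (Sum.elim θ (-θ)) (0 : Fin r → ℝ) k : ℝ) : ℂ) := by
    have hd : (fun k ↦ ((Sum.elim (Sum.elim θ (-θ)) (0 : Fin r → ℝ) k : ℝ) : ℂ)) =
        Sum.elim (Sum.elim (fun k ↦ (θ k : ℂ)) fun k ↦ -(θ k : ℂ)) fun _ ↦ 0 := by
      ext ((k | k) | k) <;> simp
    have hneg : ∀ k, I * c * (I * (θ k : ℂ)) = -(c * θ k) := fun k ↦ by
      linear_combination c * θ k * I_mul_I
    rw [hd]
    ext ((i | i) | i) ((j | j) | j) <;>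
      simp only [W, skewCanonical, fromBlocks_map, fromBlocks_multiply, fromBlocks_smul,
        mul_diagonal] <;>
      first
      | by_cases h : i = j <;> simp [h, hneg] <;> ring
      | simp
  rw [← hZW, Matrix.mul_assoc, hWW, Matrix.mul_one]

lemma HasSpectralForm.conj {ι κ ρ : Type*} [Fintype ι] [DecidableEq ι] [Fintype κ]
    [DecidableEq κ] [Fintype ρ] [DecidableEq ρ] {Z : Matrix ι ι ℂ} {d : κ → ℝ}
    (hZ : HasSpectralForm Z d) {V : Matrix ρ ι ℂ} (hV : V * Vᴴ = 1) (hV' : Vᴴ * V = 1) :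
    HasSpectralForm (V * Z * Vᴴ) d := by
  obtain ⟨U, hU, hU', rfl⟩ := hZ
  refine ⟨V * U, ?_, ?_, ?_⟩
  · calc V * U * (V * U)ᴴ = V * (U * Uᴴ) * Vᴴ := by
          simp only [conjTranspose_mul, Matrix.mul_assoc]
      _ = 1 := by rw [hU, Matrix.mul_one, hV]
  · calc (V * U)ᴴ * (V * U) = Uᴴ * (Vᴴ * V) * U := by
          simp only [conjTranspose_mul, Matrix.mul_assoc]
      _ = 1 := by rw [hV', Matrix.mul_one, hU']
  · simp only [conjTranspose_mul, Matrix.mul_assoc]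

lemma map_ofReal_mul {α β γ : Type*} [Fintype β] (A : Matrix α β ℝ) (B : Matrix β γ ℝ) :
    (A * B).map Complex.ofReal = A.map Complex.ofReal * B.map Complex.ofReal :=
  Matrix.map_mul (f := Complex.ofRealHom)

lemma HasSpectralForm.conj_ofReal {ι κ ρ : Type*} [Fintype ι] [DecidableEq ι] [Fintype κ]
    [DecidableEq κ] [Fintype ρ] [DecidableEq ρ] {X : Matrix ι ι ℝ} {d : κ → ℝ}
    (hX : HasSpectralForm (Complex.I • X.map Complex.ofReal) d) {V : Matrix ρ ι ℝ}
    (hV : V * Vᵀ = 1) (hV' : Vᵀ * V = 1) :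
    HasSpectralForm (Complex.I • (V * X * Vᵀ).map Complex.ofReal) d := by
  have hstar : (V.map Complex.ofReal)ᴴ = Vᵀ.map Complex.ofReal := by
    ext i j
    simp
  have h := hX.conj (V := V.map Complex.ofReal) ?_ ?_
  · simpa [hstar, map_ofReal_mul] using h
  · rw [hstar, ← map_ofReal_mul, hV]
    simp
  · rw [hstar, ← map_ofReal_mul, hV']
    simp

lemma trace_mul_re_le_of_mem_convexHull {n : ℕ} {M N : Matrix (Fin n) (Fin n) ℝ}
    {P : Matrix (Fin n) (Fin n) ℂ} {c : ℝ}
    (h : ∀ g ∈ Matrix.orthogonalGroup (Fin n) ℝ,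
      (P * (Complex.I • (g * M * gᵀ).map Complex.ofReal)).trace.re ≤ c)
    (hN : N ∈ convexHull ℝ {m : Matrix (Fin n) (Fin n) ℝ |
        ∃ g ∈ Matrix.orthogonalGroup (Fin n) ℝ, m = g * M * gᵀ}) :
    (P * (Complex.I • N.map Complex.ofReal)).trace.re ≤ c := by
  have hconv : Convex ℝ {X : Matrix (Fin n) (Fin n) ℝ |
      (P * (Complex.I • X.map Complex.ofReal)).trace.re ≤ c} := by
    refine convex_halfSpace_le ⟨fun X Y ↦ ?_, fun a X ↦ ?_⟩ c
    · rw [Matrix.map_add _ Complex.ofReal_add, smul_add, Matrix.mul_add, trace_add,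
        Complex.add_re]
    · have : (a • X).map Complex.ofReal = (a : ℂ) • X.map Complex.ofReal := by
        ext i j
        simp
      rw [this, smul_comm, Matrix.mul_smul, trace_smul]
      simp
  refine convexHull_min ?_ hconv hN
  rintro _ ⟨g, hg, rfl⟩
  exact h g hg

end Complexification

/-- Let `M`, `N` be real skew-symmetric `n × n` matrices. Then `N` lies in the
convex hull of `{g M gᵀ : g ∈ O(n)}` iff for every `p = 1, …, n` the sum of the `p` largest
eigenvalues of the Hermitian matrix `iN` is at most that of `iM`. -/
theorem mem_skew_schurHorn_orbitope_iff
    {n : ℕ} (M N : Matrix (Fin n) (Fin n) ℝ)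
    (hM : Mᵀ = -M) (hN : Nᵀ = -N) :
    N ∈ convexHull ℝ {m : Matrix (Fin n) (Fin n) ℝ |
        ∃ g ∈ Matrix.orthogonalGroup (Fin n) ℝ, m = g * M * gᵀ} ↔
      ∀ p : ℕ, 1 ≤ p → p ≤ n →
        sumLargest (isHermitian_I_smul_of_skew hN).eigenvalues p ≤
          sumLargest (isHermitian_I_smul_of_skew hM).eigenvalues p := by
  constructor
  · intro hmem p _ hp
    obtain ⟨s, rfl, hsum⟩ :=
      exists_sumLargest_eq (isHermitian_I_smul_of_skew hN).eigenvalues (p := p) (by simpa)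
    obtain ⟨P, hP, htr⟩ :=
      (isHermitian_I_smul_of_skew hN).hasSpectralForm.exists_trace_mul_re_eq s
    rw [hsum, ← htr]
    refine trace_mul_re_le_of_mem_convexHull (fun g hg ↦ ?_) hmem
    have hg' := (mem_orthogonalGroup_iff _ _).1 hg
    exact ((isHermitian_I_smul_of_skew hM).hasSpectralForm.conj_ofReal hg'
      (mul_eq_one_comm.1 hg')).trace_mul_re_le (by simpa) hP
  · intro h
    obtain ⟨U, a, ha, hU, hU', hNU⟩ := exists_skewCanonical N hN
    obtain ⟨V, b, hb, hV, hV', hMV⟩ := exists_skewCanonical M hM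
    have hNs := hNU ▸ (hasSpectralForm_skewCanonical _ a).conj_ofReal hU hU'
    have hMs := hMV ▸ (hasSpectralForm_skewCanonical _ b).conj_ofReal hV hV'
    have hmaj : ∀ s : Finset (Fin (n / 2)), ∃ t : Finset (Fin (n / 2)), t.card ≤ s.card ∧
        ∑ j ∈ s, a j ≤ ∑ j ∈ t, b j := by
      intro s
      rcases s.eq_empty_or_nonempty with rfl | hne
      · exact ⟨∅, by simp⟩
      have hcard : s.card ≤ n := by
        have := s.card_le_univ
        simp only [Fintype.card_fin] at this
        omega
      obtain ⟨P, hP, hPs⟩ := hNs.exists_trace_mul_re_eq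
        (s.map ((Function.Embedding.inl).trans Function.Embedding.inl))
      have h1 := (isHermitian_I_smul_of_skew hN).hasSpectralForm.trace_mul_re_le
        (by simpa using hcard) hP
      rw [hPs, Finset.card_map] at h1
      have h2 := h s.card hne.card_pos hcard
      obtain ⟨s', hs', hsum⟩ := exists_sumLargest_eq
        (isHermitian_I_smul_of_skew hM).eigenvalues (p := s.card) (by simpa)
      obtain ⟨Q, hQ, hQs⟩ :=
        (isHermitian_I_smul_of_skew hM).hasSpectralForm.exists_trace_mul_re_eq s'
      have hcard' : s.card ≤
          Fintype.card ((Fin (n / 2) ⊕ Fin (n / 2)) ⊕ Fin (n % 2)) := by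
        simp
        omega
      have h3 := hMs.trace_mul_re_le (hs'.symm ▸ hcard') hQ
      obtain ⟨t, ht, htsum⟩ := exists_sumLargest_eq
        (Sum.elim (Sum.elim b (-b)) (0 : Fin (n % 2) → ℝ)) hcard'
      rw [hs', htsum, hQs, ← hsum] at h3
      refine ⟨t.toLeft.toLeft, ?_, ?_⟩
      · rw [← ht]
        exact t.toLeft.card_toLeft_le.trans t.card_toLeft_le
      · calc ∑ j ∈ s, a j = ∑ k ∈ s.map ((Function.Embedding.inl).trans Function.Embedding.inl),
                Sum.elim (Sum.elim a (-a)) (0 : Fin (n % 2) → ℝ) k := by simp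
          _ ≤ ∑ k ∈ t, Sum.elim (Sum.elim b (-b)) (0 : Fin (n % 2) → ℝ) k := by
                linarith
          _ ≤ ∑ j ∈ t.toLeft.toLeft, b j := by
                rw [Finset.sum_sum_eq_sum_toLeft_add_sum_toRight,
                  Finset.sum_sum_eq_sum_toLeft_add_sum_toRight]
                have : ∑ j ∈ t.toLeft.toRight, -b j ≤ 0 :=
                  Finset.sum_nonpos fun j _ ↦ neg_nonpos.2 (hb j)
                simpa using this
    have hconv := mem_convexHull_signed_perm ha hb hmaj
    set L : (Fin (n / 2) → ℝ) →ₗ[ℝ] Matrix (Fin n) (Fin n) ℝ :=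
      { toFun := fun θ ↦ U * skewCanonical (n % 2) θ * Uᵀ
        map_add' := fun θ η ↦ by rw [skewCanonical_add, Matrix.mul_add, Matrix.add_mul]
        map_smul' := fun c θ ↦ by simp [skewCanonical_smul] }
    have himage := Set.mem_image_of_mem L hconv
    rw [L.image_convexHull] at himage
    have hLa : L a = N := hNU.symm
    rw [hLa] at himage
    refine convexHull_mono ?_ himage
    rintro _ ⟨_, ⟨⟨ε, σ⟩, rfl⟩, rfl⟩
    obtain ⟨Q, hQ, hQb⟩ := exists_orthogonal_conj_skewCanonical (n % 2) ε σ b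
    refine ⟨U * Q * Vᵀ, ?_, ?_⟩
    · rw [mem_orthogonalGroup_iff]
      calc U * Q * Vᵀ * (U * Q * Vᵀ)ᵀ = U * (Q * (Vᵀ * V) * Qᵀ) * Uᵀ := by
            simp only [transpose_mul, transpose_transpose, Matrix.mul_assoc]
        _ = 1 := by rw [hV', Matrix.mul_one, hQ, Matrix.mul_one, hU]
    · calc L _ = U * (Q * skewCanonical (n % 2) b * Qᵀ) * Uᵀ := by rw [← hQb]; rfl
        _ = U * (Q * ((Vᵀ * V) * skewCanonical (n % 2) b * (Vᵀ * V)) * Qᵀ) * Uᵀ := by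
            rw [hV', Matrix.mul_one, Matrix.one_mul]
        _ = U * Q * Vᵀ * (V * skewCanonical (n % 2) b * Vᵀ) * (U * Q * Vᵀ)ᵀ := by
            simp only [transpose_mul, transpose_transpose, Matrix.mul_assoc]
        _ = U * Q * Vᵀ * M * (U * Q * Vᵀ)ᵀ := by rw [← hMV]
end

section
/- Fix n ≥ 1. Let e : Mat_n(ℝ) → Mat_{2n+1}(ℝ) be the injective linear map sending B to the symmetric matrix B₀ whose top-right n×n corner (rows 1,…,n, columns n+2,…,2n+1) equals B, whose bottom-left corner equals Bᵀ, and all of whose other entries are zero (in particular the (n+1)-st row and column of B₀ are zero). Let K := {diag(u, v) : u ∈ SO(n+1), v ∈ SO(n)} ⊆ SO(2n+1), embedded block-diagonally. Then for B, M ∈ Mat_n(ℝ), there exists k ∈ K with e(B) = k (e M) kᵀ if and only if e(B) and e(M) have the same characteristic polynomial. -/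
open Matrix

/-- The injective linear embedding `B ↦ B₀` of `n × n` matrices into symmetric
`(2n+1) × (2n+1)` matrices: the top-right `n × n` corner is `B`, the bottom-left corner is
`Bᵀ`, and all other entries (in particular the whole middle row and column) are zero.
The row/column index set `(Fin n ⊕ Fin 1) ⊕ Fin n` plays the role of `Fin (2n+1)`,
grouped so that the first block has size `n + 1`. -/
def matEmb {n : ℕ} (B : Matrix (Fin n) (Fin n) ℝ) :
    Matrix ((Fin n ⊕ Fin 1) ⊕ Fin n) ((Fin n ⊕ Fin 1) ⊕ Fin n) ℝ :=
  Matrix.fromBlocks 0 (Matrix.fromRows B 0) (Matrix.fromRows B 0)ᵀ 0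

theorem eval_charpoly_fromBlocks_zero_zero {m n : Type*} [Fintype m] [DecidableEq m] [Fintype n]
    [DecidableEq n] {K : Type*} [Field K] (C : Matrix m n K) (D : Matrix n m K) {t : K}
    (ht : t ≠ 0) :
    t ^ Fintype.card n * (fromBlocks 0 C D 0).charpoly.eval t =
      t ^ Fintype.card m * (D * C).charpoly.eval (t ^ 2) := by
  have hsc : scalar (m ⊕ n) t - fromBlocks 0 C D 0 =
      fromBlocks (t • (1 : Matrix m m K)) (-C) (-D) (t • (1 : Matrix n n K)) := by
    rw [scalar_apply, ← smul_one_eq_diagonal, ← fromBlocks_one, fromBlocks_smul, sub_eq_add_neg,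
      fromBlocks_neg, fromBlocks_add]
    simp
  have hmul : t • (1 : Matrix m m K) * (t⁻¹ • (1 : Matrix m m K)) = 1 := by simp [ht]
  let : Invertible (t • (1 : Matrix m m K)) := invertibleOfRightInverse _ _ hmul
  have hinv : ⅟(t • (1 : Matrix m m K)) = t⁻¹ • (1 : Matrix m m K) := rfl
  have hmat : scalar n (t ^ 2) - D * C = t • (t • (1 : Matrix n n K) - t⁻¹ • (D * C)) := by
    rw [scalar_apply, ← smul_one_eq_diagonal, smul_sub, smul_smul, smul_smul,
      mul_inv_cancel₀ ht, one_smul, sq]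
  rw [eval_charpoly, eval_charpoly, hsc, det_fromBlocks₁₁, hinv, hmat]
  simp only [det_smul, det_one, Matrix.neg_mul, Matrix.mul_neg, Matrix.mul_smul, Matrix.mul_one,
    Matrix.smul_mul, neg_neg, smul_neg, mul_one]
  ring

theorem exists_mem_orthogonalGroup_mul_eq {n : Type*} [Fintype n] [DecidableEq n]
    {X Y : Matrix n n ℝ} (h : Xᵀ * X = Yᵀ * Y) :
    ∃ w ∈ orthogonalGroup n ℝ, Y = w * X := by
  set f := toEuclideanLin X
  set g := toEuclideanLin Y
  have hadj (Z : Matrix n n ℝ) : toEuclideanLin (Zᵀ * Z) =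
      (toEuclideanLin Z).adjoint ∘ₗ toEuclideanLin Z := by
    rw [← toEuclideanLin_conjTranspose_eq_adjoint, conjTranspose_eq_transpose_of_trivial]
    ext x : 1
    simp [toLpLin_apply]
  have hnorm (x) : ‖f x‖ = ‖g x‖ := by
    have hxx : f.adjoint (f x) = g.adjoint (g x) := by
      have := congrArg (fun Z ↦ toEuclideanLin Z x) h
      simpa [hadj] using this
    rw [← sq_eq_sq₀ (norm_nonneg _) (norm_nonneg _), ← real_inner_self_eq_norm_sq,
      ← real_inner_self_eq_norm_sq, ← LinearMap.adjoint_inner_left, hxx,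
      LinearMap.adjoint_inner_left]
  obtain ⟨s, hs⟩ := f.rangeRestrict.exists_rightInverse_of_surjective f.range_rangeRestrict
  have hfs (y : LinearMap.range f) : f (s y) = y := congrArg Subtype.val (LinearMap.congr_fun hs y)
  let L : LinearMap.range f →ₗᵢ[ℝ] EuclideanSpace ℝ n :=
    { toLinearMap := g ∘ₗ s
      norm_map' := fun y ↦ by simp [← hnorm, hfs] }
  have hL (x) : L.extend (f x) = g x := by
    have hx := L.extend_apply (f.rangeRestrict x)
    change L.extend (f x) = _ at hx
    rw [hx, ← sub_eq_zero, ← norm_eq_zero]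
    change ‖g (s (f.rangeRestrict x)) - g x‖ = 0
    rw [← map_sub, ← hnorm, map_sub, hfs]
    simp
  refine ⟨toEuclideanLin.symm L.extend.toLinearMap, ?_, ?_⟩
  · rw [mem_orthogonalGroup_iff']
    apply toEuclideanLin.injective
    rw [hadj, LinearEquiv.apply_symm_apply]
    refine LinearMap.ext fun x ↦ ext_inner_right ℝ fun y ↦ ?_
    rw [LinearMap.comp_apply, LinearMap.adjoint_inner_left]
    simp
  · apply toEuclideanLin.injective
    refine LinearMap.ext fun x ↦ ?_
    have hcomp (W : Matrix n n ℝ) : toEuclideanLin (W * X) x = toEuclideanLin W (f x) := by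
      simp [f, toLpLin_apply]
    rw [hcomp, LinearEquiv.apply_symm_apply]
    exact (hL x).symm

theorem det_sq_of_mem_orthogonalGroup {n : Type*} [Fintype n] [DecidableEq n]
    {v : Matrix n n ℝ} (hv : v ∈ orthogonalGroup n ℝ) : v.det * v.det = 1 := by
  rw [mem_orthogonalGroup_iff] at hv
  simpa using congrArg det hv

theorem diagonal_mem_orthogonalGroup {n : Type*} [Fintype n] [DecidableEq n] {d : n → ℝ}
    (hd : ∀ i, d i * d i = 1) : diagonal d ∈ orthogonalGroup n ℝ := by
  rw [mem_orthogonalGroup_iff, diagonal_transpose, diagonal_mul_diagonal]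
  simp [hd]

theorem exists_mem_specialOrthogonalGroup_conj {n : Type*} [Fintype n] [DecidableEq n]
    [Nonempty n] {P Q : Matrix n n ℝ} (hP : P.IsHermitian) (hQ : Q.IsHermitian)
    (h : P.charpoly = Q.charpoly) :
    ∃ v ∈ specialOrthogonalGroup n ℝ, P = v * Q * vᵀ := by
  have hPs := hP.spectral_theorem
  have hQs := hQ.spectral_theorem
  rw [← (hP.eigenvalues_eq_eigenvalues_iff hQ).2 h] at hQs
  rw [Unitary.conjStarAlgAut_apply] at hPs hQs
  set U : Matrix n n ℝ := hP.eigenvectorUnitary.1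
  set V : Matrix n n ℝ := hQ.eigenvectorUnitary.1
  have hU : U ∈ orthogonalGroup n ℝ := hP.eigenvectorUnitary.2
  have hV : V ∈ orthogonalGroup n ℝ := hQ.eigenvectorUnitary.2
  have hU2 := det_sq_of_mem_orthogonalGroup hU
  have hV2 := det_sq_of_mem_orthogonalGroup hV
  have hVV := (mem_orthogonalGroup_iff' _ _).1 hV
  have hVt : Vᵀ ∈ orthogonalGroup n ℝ := Unitary.star_mem hV
  set E : Matrix n n ℝ := diagonal (RCLike.ofReal ∘ hP.eigenvalues)
  let i₀ : n := Classical.arbitrary n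
  let d : n → ℝ := Function.update 1 i₀ (U.det * V.det)
  have hd (i) : d i * d i = 1 := by
    by_cases hi : i = i₀
    · subst hi
      simp only [d, Function.update_self]
      linear_combination V.det * V.det * hU2 + hV2
    · simp [d, hi]
  have hdO := diagonal_mem_orthogonalGroup hd
  refine ⟨U * diagonal d * Vᵀ,
    (mem_specialOrthogonalGroup_iff).2 ⟨mul_mem (mul_mem hU hdO) hVt, ?_⟩, ?_⟩
  · rw [det_mul, det_mul, det_transpose, det_diagonal,
      Finset.prod_update_of_mem (Finset.mem_univ _)]
    simp only [Pi.one_apply, Finset.prod_const_one, mul_one]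
    linear_combination V.det * V.det * hU2 + hV2
  · have hQ' : Q = V * E * Vᵀ := hQs
    have hP' : P = U * E * Uᵀ := hPs
    have hcomm : diagonal d * E * diagonal d = E := by
      simp only [E, diagonal_mul_diagonal]
      congr 1
      ext i
      linear_combination (RCLike.ofReal ∘ hP.eigenvalues) i * hd i
    calc P = U * (diagonal d * E * diagonal d) * Uᵀ := by rw [hcomm, hP']
      _ = U * diagonal d * (Vᵀ * V) * E * (Vᵀ * V) * diagonal d * Uᵀ := by
        rw [hVV]; simp only [Matrix.mul_one, Matrix.mul_assoc]
      _ = _ := by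
        rw [hQ']
        simp only [transpose_mul, transpose_transpose, diagonal_transpose, Matrix.mul_assoc]

theorem charpoly_transpose_mul_self_eq {n : ℕ} {B M : Matrix (Fin n) (Fin n) ℝ}
    (h : (matEmb B).charpoly = (matEmb M).charpoly) :
    (Bᵀ * B).charpoly = (Mᵀ * M).charpoly := by
  have hrows (Z : Matrix (Fin n) (Fin n) ℝ) :
      (fromRows Z (0 : Matrix (Fin 1) (Fin n) ℝ))ᵀ * fromRows Z (0 : Matrix (Fin 1) (Fin n) ℝ) =
        Zᵀ * Z := by
    rw [transpose_fromRows, fromCols_mul_fromRows]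
    simp
  refine Polynomial.eq_of_infinite_eval_eq _ _ ((Set.Ioi_infinite (0 : ℝ)).mono fun x hx ↦ ?_)
  have ht : √x ≠ 0 := (Real.sqrt_pos.2 hx).ne'
  have hB := eval_charpoly_fromBlocks_zero_zero
    (fromRows B (0 : Matrix (Fin 1) (Fin n) ℝ)) (fromRows B (0 : Matrix (Fin 1) (Fin n) ℝ))ᵀ ht
  have hM := eval_charpoly_fromBlocks_zero_zero
    (fromRows M (0 : Matrix (Fin 1) (Fin n) ℝ)) (fromRows M (0 : Matrix (Fin 1) (Fin n) ℝ))ᵀ ht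
  rw [hrows, Real.sq_sqrt (le_of_lt hx)] at hB hM
  rw [← matEmb] at hB hM
  rw [h, hM] at hB
  exact (mul_left_cancel₀ (pow_ne_zero _ ht) hB).symm

/-- for `B, M ∈ Mat_n(ℝ)`, there is `k ∈ K = {diag(u,v) : u ∈ SO(n+1), v ∈ SO(n)}`
with `B₀ = k M₀ kᵀ` if and only if `B₀` and `M₀` have the same characteristic polynomial. -/
theorem exists_conj_matEmb_iff_charpoly_eq
    {n : ℕ} (hn : 1 ≤ n) (B M : Matrix (Fin n) (Fin n) ℝ) :
    (∃ u ∈ Matrix.specialOrthogonalGroup (Fin n ⊕ Fin 1) ℝ,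
        ∃ v ∈ Matrix.specialOrthogonalGroup (Fin n) ℝ,
          matEmb B = Matrix.fromBlocks u 0 0 v * matEmb M * (Matrix.fromBlocks u 0 0 v)ᵀ) ↔
      (matEmb B).charpoly = (matEmb M).charpoly := by
  constructor
  · rintro ⟨u, hu, v, hv, h⟩
    have hu' := (mem_orthogonalGroup_iff' _ _).1 (mem_specialOrthogonalGroup_iff.1 hu).1
    have hv' := (mem_orthogonalGroup_iff' _ _).1 (mem_specialOrthogonalGroup_iff.1 hv).1
    rw [h, charpoly_mul_comm, ← Matrix.mul_assoc, fromBlocks_transpose, fromBlocks_multiply]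
    simp [hu', hv']
  · intro h
    have : Nonempty (Fin n) := ⟨⟨0, hn⟩⟩
    have hherm (Z : Matrix (Fin n) (Fin n) ℝ) : (Zᵀ * Z).IsHermitian :=
      isHermitian_conjTranspose_mul_self Z
    obtain ⟨v, hv, hconj⟩ := exists_mem_specialOrthogonalGroup_conj (hherm B) (hherm M)
      (charpoly_transpose_mul_self_eq h)
    obtain ⟨w, hw, hBw⟩ := exists_mem_orthogonalGroup_mul_eq (X := M * vᵀ) (Y := B) <| by
      rw [hconj]
      simp only [transpose_mul, transpose_transpose, Matrix.mul_assoc]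
    have hw2 := det_sq_of_mem_orthogonalGroup hw
    have hww := (mem_orthogonalGroup_iff _ _).1 hw
    refine ⟨fromBlocks w 0 0 (w.det • 1), mem_specialOrthogonalGroup_iff.2 ⟨?_, ?_⟩, v, hv, ?_⟩
    · rw [mem_orthogonalGroup_iff, fromBlocks_transpose, fromBlocks_multiply]
      simp [hww, smul_smul, hw2]
    · rw [det_fromBlocks_zero₂₁]
      simp [hw2]
    · have hrows : fromBlocks w 0 0 (w.det • (1 : Matrix (Fin 1) (Fin 1) ℝ)) *
          fromRows M (0 : Matrix (Fin 1) (Fin n) ℝ) * vᵀ = fromRows B 0 := by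
        rw [fromBlocks_mul_fromRows, fromRows_mul]
        simp [hBw, Matrix.mul_assoc]
      rw [matEmb, matEmb, ← hrows]
      generalize fromBlocks w 0 0 (w.det • (1 : Matrix (Fin 1) (Fin 1) ℝ)) = u
      generalize fromRows M (0 : Matrix (Fin 1) (Fin n) ℝ) = R
      rw [fromBlocks_transpose, fromBlocks_multiply, fromBlocks_multiply]
      simp [Matrix.mul_assoc]
end

section
/- Let X be a real symmetric n×n matrix and let O_X := convexHull{g X gᵀ : g ∈ O(n)} be the symmetric Schur–Horn orbitope, a compact convex subset of the real vector space of n×n real matrices. Then every face of O_X is exposed: if F ⊆ O_X is a convex extreme subset of O_X, then F is an exposed face of O_X. -/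
open Matrix

open Finset Filter Topology

/-- A nonempty convex set in a finite-dimensional space has a point from which every segment inside
the set can be prolonged. -/
theorem Convex.exists_forall_add_smul_sub_mem {V : Type*} [NormedAddCommGroup V] [NormedSpace ℝ V]
    [FiniteDimensional ℝ V] {s : Set V} (hs : Convex ℝ s) (hne : s.Nonempty) :
    ∃ a ∈ s, ∀ b ∈ s, ∃ ε : ℝ, 0 < ε ∧ a + ε • (a - b) ∈ s := by
  obtain ⟨a, ha⟩ := hne.intrinsicInterior hs
  refine ⟨a, intrinsicInterior_subset ha, fun b hb => ?_⟩
  obtain ⟨y, hy, rfl⟩ := mem_intrinsicInterior.1 ha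
  let b' : affineSpan ℝ s := ⟨b, subset_affineSpan ℝ s hb⟩
  have : Nonempty (affineSpan ℝ s) := ⟨b'⟩
  have hc : ContinuousAt (fun t : ℝ => AffineMap.lineMap y b' t) 0 :=
    AffineMap.lineMap_continuous.continuousAt
  have hev : ∀ᶠ t in 𝓝 (0 : ℝ),
      AffineMap.lineMap y b' t ∈ ((↑) ⁻¹' s : Set (affineSpan ℝ s)) :=
    hc.eventually (by
      beta_reduce
      rw [AffineMap.lineMap_apply_zero]
      exact mem_interior_iff_mem_nhds.1 hy)
  obtain ⟨δ, hδ, h⟩ := Metric.eventually_nhds_iff.1 hev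
  refine ⟨δ / 2, by positivity, ?_⟩
  have h2 := h (y := -(δ / 2)) (by simp [abs_of_pos hδ]; linarith)
  have h3 : ((AffineMap.lineMap y b' (-(δ / 2)) : affineSpan ℝ s) : V)
      = (y : V) + (δ / 2) • ((y : V) - b) := by
    rw [AffineMap.lineMap_apply]
    simp only [AffineSubspace.coe_vadd, Submodule.coe_smul, AffineSubspace.coe_vsub, vsub_eq_sub,
      vadd_eq_add, b']
    module
  simpa [h3] using h2

/-- The sum of the first `k` entries of a vector. -/
def headSum {n : ℕ} (k : ℕ) (a : Fin n → ℝ) : ℝ :=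
  ∑ i ∈ univ.filter fun i : Fin n => (i : ℕ) < k, a i

theorem headSum_succ {n : ℕ} (a : Fin n → ℝ) (j : Fin n) :
    headSum (j + 1) a = headSum j a + a j := by
  have : (univ.filter fun i : Fin n => (i : ℕ) < j + 1)
      = insert j (univ.filter fun i : Fin n => (i : ℕ) < j) := by
    ext i
    simp [Fin.ext_iff]
    omega
  rw [headSum, headSum, this, sum_insert (by simp), add_comm]

theorem headSum_of_le {n k : ℕ} (h : n ≤ k) (a : Fin n → ℝ) : headSum k a = ∑ i, a i := by
  rw [headSum, filter_true_of_mem (fun i _ => i.isLt.trans_le h)]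

theorem headSum_add {n : ℕ} (k : ℕ) (a b : Fin n → ℝ) :
    headSum k (a + b) = headSum k a + headSum k b := sum_add_distrib

theorem headSum_smul {n : ℕ} (k : ℕ) (r : ℝ) (a : Fin n → ℝ) :
    headSum k (r • a) = r * headSum k a := (mul_sum _ _ _).symm

/-- Abel summation inequality: an antitone weight against a sequence with nonnegative
partial sums. -/
theorem mul_sum_le_sum_mul_of_antitone {n : ℕ} {y e : Fin n → ℝ} (hy : Antitone y)
    (he : ∀ k ≤ n, 0 ≤ headSum k e) {c : ℝ} (hc : ∀ i, c ≤ y i) :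
    c * ∑ i, e i ≤ ∑ i, y i * e i := by
  induction n generalizing c with
  | zero => simp
  | succ n ih =>
    have hpre := ih (y := fun i => y i.castSucc) (e := fun i => e i.castSucc)
      (fun i j h => hy (by simpa using h))
      (fun k hk => by
        have := he k (by omega)
        simp only [headSum, sum_filter, Fin.sum_univ_castSucc, Fin.val_castSucc, Fin.val_last,
          if_neg (not_lt.2 hk), add_zero] at this
        simpa only [headSum, sum_filter] using this)
      (c := y (Fin.last n)) (fun i => hy (Fin.le_last _))
    have htot : 0 ≤ ∑ i, e i := by
      have := he (n + 1) le_rfl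
      rwa [headSum_of_le le_rfl] at this
    have hle := mul_le_mul_of_nonneg_right (hc (Fin.last n)) htot
    rw [Fin.sum_univ_castSucc] at hle ⊢
    rw [Fin.sum_univ_castSucc]
    linarith [mul_add (y (Fin.last n)) (∑ i : Fin n, e i.castSucc) (e (Fin.last n))]

theorem exists_antitone_comp_perm {n : ℕ} (y : Fin n → ℝ) :
    ∃ σ : Equiv.Perm (Fin n), Antitone (y ∘ σ) := by
  refine ⟨Tuple.sort (-y), fun i j h => ?_⟩
  have := Tuple.monotone_sort (-y) h
  simpa using this

/-- Rado's theorem: a vector majorized by `x` is in the convex hull of the permutations of `x`. -/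
theorem mem_convexHull_perm_of_headSum_le {n : ℕ} {a x : Fin n → ℝ}
    (hsum : ∑ i, a i = ∑ i, x i)
    (h : ∀ σ : Equiv.Perm (Fin n), ∀ k ≤ n, headSum k (a ∘ σ) ≤ headSum k x) :
    a ∈ convexHull ℝ (Set.range fun σ : Equiv.Perm (Fin n) => x ∘ σ) := by
  by_contra hmem
  obtain ⟨l, u, hlu, hua⟩ := geometric_hahn_banach_closed_point (convex_convexHull ℝ _)
    ((Set.finite_range _).isClosed_convexHull ℝ) hmem
  let y : Fin n → ℝ := fun i => l (Pi.single i 1)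
  have hl : ∀ v, l v = ∑ i, y i * v i := fun v => by
    conv_lhs => rw [← Finset.univ_sum_single v]
    rw [map_sum]
    refine sum_congr rfl fun i _ => ?_
    have : (Pi.single i (v i) : Fin n → ℝ) = v i • Pi.single i (1 : ℝ) := by
      simp [← Pi.single_smul]
    rw [this, map_smul, smul_eq_mul, mul_comm]
  obtain ⟨σ, hσ⟩ := exists_antitone_comp_perm y
  have hx := hlu (x ∘ σ.symm) (subset_convexHull ℝ _ ⟨σ.symm, rfl⟩)
  have hlt := hx.trans hua
  rw [hl, hl, ← Equiv.sum_comp σ fun i => y i * (x ∘ σ.symm) i,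
    ← Equiv.sum_comp σ fun i => y i * a i] at hlt
  rcases n.eq_zero_or_pos with rfl | hn
  · simp at hlt
  have key := mul_sum_le_sum_mul_of_antitone hσ (e := x - a ∘ σ)
    (fun k hk => by
      have := h σ k hk
      rw [headSum, headSum] at this
      simpa [headSum] using this)
    (c := (y ∘ σ) ⟨n - 1, by omega⟩)
    (fun i => hσ (Fin.le_def.2 (by simp; omega)))
  have hz : ∑ i, (x - a ∘ σ) i = 0 := by
    simp [Equiv.sum_comp σ a, hsum]
  rw [hz, mul_zero] at key
  simp only [Pi.sub_apply, Function.comp_apply, mul_sub, sum_sub_distrib,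
    Equiv.symm_apply_apply] at key hlt
  linarith

theorem Equiv.Perm.permMatrix_mul_diagonal_mul_transpose {n : ℕ} (σ : Equiv.Perm (Fin n))
    (x : Fin n → ℝ) :
    σ.permMatrix ℝ * diagonal x * (σ.permMatrix ℝ)ᵀ = diagonal (x ∘ σ) := by
  ext i j
  rw [Matrix.mul_apply]
  simp [Matrix.mul_diagonal, Equiv.Perm.permMatrix, PEquiv.toMatrix_apply, diagonal_apply,
    Equiv.toPEquiv_apply, eq_comm]
  split_ifs with h <;> simp [h]

theorem Equiv.Perm.permMatrix_mem_orthogonalGroup {n : ℕ} (σ : Equiv.Perm (Fin n)) :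
    σ.permMatrix ℝ ∈ orthogonalGroup (Fin n) ℝ := by
  rw [mem_orthogonalGroup_iff]
  have := σ.permMatrix_mul_diagonal_mul_transpose (fun _ => 1)
  simpa [Function.comp_def] using this

theorem exists_orthogonal_diagonalization {n : ℕ} {A : Matrix (Fin n) (Fin n) ℝ}
    (hA : A.IsHermitian) :
    ∃ u ∈ orthogonalGroup (Fin n) ℝ, ∃ a : Fin n → ℝ, Antitone a ∧ A = u * diagonal a * uᵀ := by
  obtain ⟨σ, hσ⟩ := exists_antitone_comp_perm hA.eigenvalues
  have hspec := hA.spectral_theorem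
  rw [Unitary.conjStarAlgAut_apply] at hspec
  refine ⟨hA.eigenvectorUnitary * (σ.permMatrix ℝ)ᵀ, mul_mem hA.eigenvectorUnitary.2 ?_,
    _, hσ, ?_⟩
  · have := σ.permMatrix_mem_orthogonalGroup
    rw [mem_orthogonalGroup_iff']
    rwa [mem_orthogonalGroup_iff, ← transpose_transpose (σ.permMatrix ℝ)] at this
  · have h1 := (mem_orthogonalGroup_iff' _ _).1 σ.permMatrix_mem_orthogonalGroup
    rw [← σ.permMatrix_mul_diagonal_mul_transpose]
    conv_lhs => rw [hspec]
    simp only [transpose_mul, transpose_transpose, Matrix.mul_assoc]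
    rw [← Matrix.mul_assoc (σ.permMatrix ℝ)ᵀ, h1, ← Matrix.mul_assoc (σ.permMatrix ℝ)ᵀ, h1]
    simp [star_eq_conjTranspose, conjTranspose_eq_transpose_of_trivial]

theorem transpose_mem_orthogonalGroup {n : ℕ} {u : Matrix (Fin n) (Fin n) ℝ}
    (hu : u ∈ orthogonalGroup (Fin n) ℝ) : uᵀ ∈ orthogonalGroup (Fin n) ℝ := by
  rw [mem_orthogonalGroup_iff, transpose_transpose]
  exact (mem_orthogonalGroup_iff' _ _).1 hu

/-- The Schur–Horn orbitope of a diagonal matrix. -/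
def orbitope {n : ℕ} (x : Fin n → ℝ) : Set (Matrix (Fin n) (Fin n) ℝ) :=
  convexHull ℝ {m | ∃ g ∈ orthogonalGroup (Fin n) ℝ, m = g * diagonal x * gᵀ}

theorem convex_orbitope {n : ℕ} (x : Fin n → ℝ) : Convex ℝ (orbitope x) := convex_convexHull ℝ _

theorem conj_mem_orbitope {n : ℕ} {x : Fin n → ℝ} {u : Matrix (Fin n) (Fin n) ℝ}
    (hu : u ∈ orthogonalGroup (Fin n) ℝ) {B : Matrix (Fin n) (Fin n) ℝ} (hB : B ∈ orbitope x) :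
    u * B * uᵀ ∈ orbitope x := by
  refine convexHull_min (t := {B | u * B * uᵀ ∈ orbitope x}) ?_ ?_ hB
  · rintro _ ⟨g, hg, rfl⟩
    exact subset_convexHull ℝ _ ⟨u * g, mul_mem hu hg, by simp [Matrix.mul_assoc]⟩
  · intro B hB C hC α β hα hβ hαβ
    have := convex_orbitope x hB hC hα hβ hαβ
    simpa [Matrix.mul_add, Matrix.add_mul] using this

theorem mem_orbitope_of_headSum_le {n : ℕ} {x : Fin n → ℝ} {A : Matrix (Fin n) (Fin n) ℝ}
    (hA : A.IsHermitian) (htr : A.trace = ∑ i, x i)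
    (h : ∀ g ∈ orthogonalGroup (Fin n) ℝ, ∀ k ≤ n, headSum k (g * A * gᵀ).diag ≤ headSum k x) :
    A ∈ orbitope x := by
  obtain ⟨u, hu, a, -, rfl⟩ := exists_orthogonal_diagonalization hA
  have huu := (mem_orthogonalGroup_iff' _ _).1 hu
  refine conj_mem_orbitope hu ?_
  rw [Matrix.trace_mul_comm, ← Matrix.mul_assoc, huu, Matrix.one_mul, trace_diagonal] at htr
  have ha := mem_convexHull_perm_of_headSum_le htr fun σ k hk => by
    have := h (σ.permMatrix ℝ * uᵀ)
      (mul_mem σ.permMatrix_mem_orthogonalGroup (transpose_mem_orthogonalGroup hu)) k hk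
    rwa [show σ.permMatrix ℝ * uᵀ * (u * diagonal a * uᵀ) * (σ.permMatrix ℝ * uᵀ)ᵀ
        = σ.permMatrix ℝ * (uᵀ * u) * diagonal a * (uᵀ * u) * (σ.permMatrix ℝ)ᵀ by
        simp only [transpose_mul, transpose_transpose, Matrix.mul_assoc], huu, Matrix.mul_one,
      Matrix.mul_one, σ.permMatrix_mul_diagonal_mul_transpose, diag_diagonal] at this
  refine convexHull_min (t := {v | diagonal v ∈ orbitope x}) ?_ ?_ ha
  · rintro _ ⟨σ, rfl⟩
    exact subset_convexHull ℝ _ ⟨σ.permMatrix ℝ, σ.permMatrix_mem_orthogonalGroup,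
      (σ.permMatrix_mul_diagonal_mul_transpose x).symm⟩
  · intro v hv w hw α β hα hβ hαβ
    have := convex_orbitope x hv hw hα hβ hαβ
    rwa [← diagonal_smul, ← diagonal_smul, diagonal_add] at this

/-- The first `k` coordinates of a vector, the other ones being replaced by zero. -/
def headPart {n : ℕ} (k : ℕ) (v : Fin n → ℝ) : Fin n → ℝ := fun i => if (i : ℕ) < k then v i else 0

/-- The coordinates of a vector from the `k`-th on, the other ones being replaced by zero. -/
def tailPart {n : ℕ} (k : ℕ) (v : Fin n → ℝ) : Fin n → ℝ := fun i => if (i : ℕ) < k then 0 else v i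

theorem conj_diag_apply {n : ℕ} (g N : Matrix (Fin n) (Fin n) ℝ) (i : Fin n) :
    (g * N * gᵀ).diag i = g i ⬝ᵥ N *ᵥ g i := by
  rw [diag_apply, Matrix.mul_assoc, Matrix.mul_apply]
  simp [dotProduct, mulVec, Matrix.mul_apply]

theorem dotProduct_mulVec_eq_sum {n : ℕ} (N : Matrix (Fin n) (Fin n) ℝ) (v : Fin n → ℝ) :
    v ⬝ᵥ N *ᵥ v = ∑ i, ∑ j, v i * N i j * v j := by
  simp [dotProduct, mulVec, mul_sum, mul_assoc]

theorem abs_dotProduct_mulVec_le {n : ℕ} (C : Matrix (Fin n) (Fin n) ℝ) (v : Fin n → ℝ) :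
    |v ⬝ᵥ C *ᵥ v| ≤ (∑ i, ∑ j, |C i j|) * (v ⬝ᵥ v) := by
  have hle : ∀ i, v i ^ 2 ≤ v ⬝ᵥ v := fun i => by
    rw [sq]
    exact single_le_sum (f := fun i => v i * v i) (fun i _ => mul_self_nonneg _) (mem_univ i)
  rw [dotProduct_mulVec_eq_sum, sum_mul]
  refine (abs_sum_le_sum_abs _ _).trans (sum_le_sum fun i _ => ?_)
  rw [sum_mul]
  refine (abs_sum_le_sum_abs _ _).trans (sum_le_sum fun j _ => ?_)
  rw [mul_right_comm, mul_comm, abs_mul]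
  refine mul_le_mul_of_nonneg_left ?_ (abs_nonneg _)
  have := hle i
  have := hle j
  rw [abs_le]
  constructor <;> nlinarith [sq_nonneg (v i - v j), sq_nonneg (v i + v j)]

/-- `N` is block diagonal with respect to the splitting of the indices at `k`. -/
def IsBlockAt {n : ℕ} (k : ℕ) (N : Matrix (Fin n) (Fin n) ℝ) : Prop :=
  ∀ i j : Fin n, (i : ℕ) < k → k ≤ j → N i j = 0 ∧ N j i = 0

theorem isBlockAt_diagonal {n : ℕ} (k : ℕ) (x : Fin n → ℝ) : IsBlockAt k (diagonal x) := by
  intro i j hi hj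
  have : i ≠ j := fun h => by subst h; omega
  simp [this, this.symm]

theorem IsBlockAt.dotProduct_mulVec_eq {n k : ℕ} {N : Matrix (Fin n) (Fin n) ℝ}
    (hN : IsBlockAt k N) (v : Fin n → ℝ) :
    v ⬝ᵥ N *ᵥ v = headPart k v ⬝ᵥ N *ᵥ headPart k v + tailPart k v ⬝ᵥ N *ᵥ tailPart k v := by
  simp only [dotProduct_mulVec_eq_sum, ← sum_add_distrib]
  refine sum_congr rfl fun i _ => sum_congr rfl fun j _ => ?_
  by_cases hi : (i : ℕ) < k <;> by_cases hj : (j : ℕ) < k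
  · simp [headPart, tailPart, hi, hj]
  · simp [headPart, tailPart, hi, hj, (hN i j hi (not_lt.1 hj)).1]
  · simp [headPart, tailPart, hi, hj, (hN j i hj (not_lt.1 hi)).2]
  · simp [headPart, tailPart, hi, hj]

theorem sum_headPart_dotProduct_mulVec {n : ℕ} (k : ℕ) (N : Matrix (Fin n) (Fin n) ℝ)
    {g : Matrix (Fin n) (Fin n) ℝ} (hg : g ∈ orthogonalGroup (Fin n) ℝ) :
    ∑ i, headPart k (g i) ⬝ᵥ N *ᵥ headPart k (g i) = headSum k N.diag := by
  simp only [dotProduct_mulVec_eq_sum]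
  rw [sum_comm, headSum, sum_filter]
  refine sum_congr rfl fun p _ => ?_
  rw [sum_comm]
  have hterm : ∀ q, ∑ i, headPart k (g i) p * N p q * headPart k (g i) q
      = if p = q then (if (p : ℕ) < k then N p p else 0) else 0 := fun q => by
    have hpq : ∑ i, g i p * g i q = if p = q then 1 else 0 := by
      have := congr_fun₂ ((mem_orthogonalGroup_iff' _ _).1 hg) p q
      simpa [Matrix.mul_apply, Matrix.one_apply] using this
    by_cases hp : (p : ℕ) < k <;> by_cases hq : (q : ℕ) < k
    · simp only [headPart, if_pos hp, if_pos hq, mul_right_comm _ (N p q), ← sum_mul, hpq]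
      split_ifs with h
      · simp [h]
      · simp
    · have : p ≠ q := fun h => hq (h ▸ hp)
      simp [headPart, hq, this]
    · simp [headPart, hp]
    · simp [headPart, hp]
  simp [hterm]

theorem IsBlockAt.headSum_diag_sub_headSum_conj_diag {n k : ℕ} {N : Matrix (Fin n) (Fin n) ℝ}
    (hN : IsBlockAt k N) {g : Matrix (Fin n) (Fin n) ℝ} (hg : g ∈ orthogonalGroup (Fin n) ℝ) :
    headSum k N.diag - headSum k (g * N * gᵀ).diag
      = ∑ i ∈ univ.filter (fun i : Fin n => ¬ (i : ℕ) < k),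
          headPart k (g i) ⬝ᵥ N *ᵥ headPart k (g i)
        - ∑ i ∈ univ.filter (fun i : Fin n => (i : ℕ) < k),
          tailPart k (g i) ⬝ᵥ N *ᵥ tailPart k (g i) := by
  rw [← sum_headPart_dotProduct_mulVec k N hg, headSum,
    ← sum_filter_add_sum_filter_not univ (fun i : Fin n => (i : ℕ) < k)]
  have hrow : ∀ i, (g * N * gᵀ).diag i = headPart k (g i) ⬝ᵥ N *ᵥ headPart k (g i)
      + tailPart k (g i) ⬝ᵥ N *ᵥ tailPart k (g i) := fun i => by
    rw [conj_diag_apply, hN.dotProduct_mulVec_eq]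
  simp only [hrow, sum_add_distrib]
  ring

theorem headSum_conj_sub_smul_one {n : ℕ} (k : ℕ) (M : Matrix (Fin n) (Fin n) ℝ) (t : ℝ)
    {g : Matrix (Fin n) (Fin n) ℝ} (hg : g ∈ orthogonalGroup (Fin n) ℝ) :
    headSum k (M - t • 1).diag - headSum k (g * (M - t • 1) * gᵀ).diag
      = headSum k M.diag - headSum k (g * M * gᵀ).diag := by
  have : g * (M - t • 1) * gᵀ = g * M * gᵀ - t • 1 := by
    simp [Matrix.mul_sub, Matrix.sub_mul, (mem_orthogonalGroup_iff _ _).1 hg]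
  rw [this]
  simp [headSum]

theorem IsBlockAt.sub_smul_one {n k : ℕ} {M : Matrix (Fin n) (Fin n) ℝ}
    (hM : IsBlockAt k M) (t : ℝ) : IsBlockAt k (M - t • 1) := by
  intro i j hi hj
  have h1 := isBlockAt_diagonal k (fun _ : Fin n => (1 : ℝ)) i j hi hj
  rw [diagonal_one] at h1
  simp [hM i j hi hj, h1]

theorem IsBlockAt.headSum_conj_diag_le {n k : ℕ} {M : Matrix (Fin n) (Fin n) ℝ}
    (hM : IsBlockAt k M) (t : ℝ)
    (hhead : ∀ v, 0 ≤ headPart k v ⬝ᵥ (M - t • 1) *ᵥ headPart k v)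
    (htail : ∀ v, tailPart k v ⬝ᵥ (M - t • 1) *ᵥ tailPart k v ≤ 0)
    {g : Matrix (Fin n) (Fin n) ℝ} (hg : g ∈ orthogonalGroup (Fin n) ℝ) :
    headSum k (g * M * gᵀ).diag ≤ headSum k M.diag := by
  have h := (hM.sub_smul_one t).headSum_diag_sub_headSum_conj_diag hg
  rw [headSum_conj_sub_smul_one k M t hg] at h
  have h1 := sum_nonneg (s := univ.filter (fun i : Fin n => ¬ (i : ℕ) < k))
    fun i _ => hhead (g i)
  have h2 := sum_nonpos (s := univ.filter (fun i : Fin n => (i : ℕ) < k))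
    fun i _ => htail (g i)
  linarith

theorem Antitone.exists_headPart_tailPart_separation {n : ℕ} {x : Fin n → ℝ} (hx : Antitone x)
    (k : ℕ) : ∃ t, (∀ i : Fin n, (i : ℕ) < k → t ≤ x i) ∧ ∀ i : Fin n, k ≤ i → x i ≤ t := by
  rcases n.eq_zero_or_pos with rfl | hn
  · exact ⟨0, fun i => i.elim0, fun i => i.elim0⟩
  refine ⟨x ⟨min (k - 1) (n - 1), by omega⟩, fun i hi => hx (Fin.le_def.2 ?_),
    fun i hi => hx (Fin.le_def.2 ?_)⟩ <;> simp <;> omega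

theorem diagonal_sub_dotProduct_mulVec {n : ℕ} (x : Fin n → ℝ) (t : ℝ) (v : Fin n → ℝ) :
    v ⬝ᵥ (diagonal x - t • (1 : Matrix (Fin n) (Fin n) ℝ)) *ᵥ v
      = ∑ i, (x i - t) * v i ^ 2 := by
  rw [sub_mulVec, smul_mulVec, one_mulVec]
  simp only [dotProduct, Pi.sub_apply, mulVec_diagonal, Pi.smul_apply, smul_eq_mul]
  exact sum_congr rfl fun i _ => by ring

/-- Ky Fan's inequality for a diagonal matrix, with its equality case. -/
theorem Antitone.headSum_conj_diagonal_le {n : ℕ} {x : Fin n → ℝ} (hx : Antitone x) (k : ℕ)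
    {g : Matrix (Fin n) (Fin n) ℝ} (hg : g ∈ orthogonalGroup (Fin n) ℝ) :
    headSum k (g * diagonal x * gᵀ).diag ≤ headSum k x ∧
      (headSum k (g * diagonal x * gᵀ).diag = headSum k x →
        IsBlockAt k (g * diagonal x * gᵀ)) := by
  obtain ⟨t, ht1, ht2⟩ := hx.exists_headPart_tailPart_separation k
  have h := ((isBlockAt_diagonal k x).sub_smul_one t).headSum_diag_sub_headSum_conj_diag hg
  rw [headSum_conj_sub_smul_one k _ t hg, diag_diagonal] at h
  simp only [diagonal_sub_dotProduct_mulVec] at h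
  have hhead : ∀ (v : Fin n → ℝ) i, 0 ≤ (x i - t) * headPart k v i ^ 2 := fun v i => by
    by_cases hi : (i : ℕ) < k
    · exact mul_nonneg (sub_nonneg.2 (ht1 i hi)) (sq_nonneg _)
    · simp [headPart, hi]
  have htail : ∀ (v : Fin n → ℝ) i, (x i - t) * tailPart k v i ^ 2 ≤ 0 := fun v i => by
    by_cases hi : (i : ℕ) < k
    · simp [tailPart, hi]
    · exact mul_nonpos_of_nonpos_of_nonneg (sub_nonpos.2 (ht2 i (not_lt.1 hi))) (sq_nonneg _)
  have h1 := sum_nonneg (s := univ.filter (fun i : Fin n => ¬ (i : ℕ) < k))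
    fun i _ => sum_nonneg fun m (_ : m ∈ univ) => hhead (g i) m
  have h2 := sum_nonpos (s := univ.filter (fun i : Fin n => (i : ℕ) < k))
    fun i _ => sum_nonpos fun m (_ : m ∈ univ) => htail (g i) m
  refine ⟨by linarith, fun heq => ?_⟩
  have e1 := (sum_eq_zero_iff_of_nonneg fun i _ =>
    sum_nonneg fun m (_ : m ∈ univ) => hhead (g i) m).1 (le_antisymm (by linarith) h1)
  have e2 := (sum_eq_zero_iff_of_nonpos fun i _ =>
    sum_nonpos fun m (_ : m ∈ univ) => htail (g i) m).1 (le_antisymm h2 (by linarith))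
  have hprod : ∀ i j : Fin n, (i : ℕ) < k → k ≤ j → ∀ m, g i m * (x m - t) * g j m = 0 := by
    intro i j hi hj m
    by_cases hm : (m : ℕ) < k
    · have := (sum_eq_zero_iff_of_nonneg fun m _ => hhead (g j) m).1
        (e1 j (by simpa using hj)) m (mem_univ m)
      simp only [headPart, if_pos hm] at this
      rcases mul_eq_zero.1 this with h | h
      · simp [h]
      · simp [pow_eq_zero_iff two_ne_zero |>.1 h]
    · have := (sum_eq_zero_iff_of_nonpos fun m _ => htail (g i) m).1
        (e2 i (by simpa using hi)) m (mem_univ m)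
      simp only [tailPart, if_neg hm] at this
      rcases mul_eq_zero.1 this with h | h
      · simp [h]
      · simp [pow_eq_zero_iff two_ne_zero |>.1 h]
  have hentry : ∀ i j : Fin n, i ≠ j →
      (g * diagonal x * gᵀ) i j = ∑ m, g i m * (x m - t) * g j m := fun i j hij => by
    have hg' := congr_fun₂ ((mem_orthogonalGroup_iff _ _).1 hg) i j
    rw [Matrix.mul_apply, Matrix.one_apply_ne hij] at hg'
    rw [Matrix.mul_apply, ← sub_zero (∑ m, _), ← mul_zero t, ← hg', mul_sum, ← sum_sub_distrib]
    exact sum_congr rfl fun m _ => by rw [mul_diagonal, transpose_apply]; ring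
  intro i j hi hj
  have hij : i ≠ j := fun h => by subst h; omega
  rw [hentry i j hij, hentry j i hij.symm]
  refine ⟨sum_eq_zero fun m _ => hprod i j hi hj m, sum_eq_zero fun m _ => ?_⟩
  rw [← hprod i j hi hj m]
  ring

theorem IsBlockAt.smul_add_smul {n k : ℕ} {B C : Matrix (Fin n) (Fin n) ℝ}
    (hB : IsBlockAt k B) (hC : IsBlockAt k C) (α β : ℝ) : IsBlockAt k (α • B + β • C) := by
  intro i j hi hj
  simp [hB i j hi hj, hC i j hi hj]

theorem isHermitian_of_mem_orbitope {n : ℕ} {x : Fin n → ℝ} {B : Matrix (Fin n) (Fin n) ℝ}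
    (hB : B ∈ orbitope x) : B.IsHermitian := by
  refine convexHull_min (t := {B | B.IsHermitian}) ?_ ?_ hB
  · rintro _ ⟨g, hg, rfl⟩
    simp [IsHermitian, conjTranspose_eq_transpose_of_trivial, Matrix.mul_assoc]
  · intro B hB C hC α β _ _ _
    change (α • B + β • C)ᴴ = _
    rw [conjTranspose_add, conjTranspose_smul, conjTranspose_smul, hB, hC, star_trivial,
      star_trivial]

theorem trace_of_mem_orbitope {n : ℕ} {x : Fin n → ℝ} {B : Matrix (Fin n) (Fin n) ℝ}
    (hB : B ∈ orbitope x) : B.trace = ∑ i, x i := by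
  refine convexHull_min (t := {B | B.trace = ∑ i, x i}) ?_ ?_ hB
  · rintro _ ⟨g, hg, rfl⟩
    rw [Set.mem_ofPred_eq, Matrix.trace_mul_comm, ← Matrix.mul_assoc,
      (mem_orthogonalGroup_iff' _ _).1 hg, Matrix.one_mul, trace_diagonal]
  · intro B hB C hC α β _ _ hαβ
    rw [Set.mem_ofPred_eq] at hB hC ⊢
    rw [trace_add, trace_smul, trace_smul, hB, hC, ← add_smul, hαβ, one_smul]

/-- Ky Fan's inequality on the orbitope, with its equality case. -/
theorem headSum_diag_le_of_mem_orbitope {n : ℕ} {x : Fin n → ℝ} (hx : Antitone x) (k : ℕ)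
    {B : Matrix (Fin n) (Fin n) ℝ} (hB : B ∈ orbitope x) :
    headSum k B.diag ≤ headSum k x ∧ (headSum k B.diag = headSum k x → IsBlockAt k B) := by
  refine convexHull_min (t := {B | headSum k B.diag ≤ headSum k x ∧
    (headSum k B.diag = headSum k x → IsBlockAt k B)}) ?_ ?_ hB
  · rintro _ ⟨g, hg, rfl⟩
    exact hx.headSum_conj_diagonal_le k hg
  · rintro B ⟨hB, hB'⟩ C ⟨hC, hC'⟩ α β hα hβ hαβ
    rcases hα.eq_or_lt with rfl | hα
    · obtain rfl : β = 1 := by linarith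
      simpa using ⟨hC, hC'⟩
    rcases hβ.eq_or_lt with rfl | hβ
    · obtain rfl : α = 1 := by linarith
      simpa using ⟨hB, hB'⟩
    have hx' : headSum k x = α * headSum k x + β * headSum k x := by
      rw [← add_mul, hαβ, one_mul]
    rw [Set.mem_ofPred_eq, diag_add, diag_smul, diag_smul, headSum_add, headSum_smul,
      headSum_smul]
    have h1 := mul_le_mul_of_nonneg_left hB hα.le
    have h2 := mul_le_mul_of_nonneg_left hC hβ.le
    refine ⟨by linarith, fun h => ?_⟩
    exact (hB' (mul_left_cancel₀ hα.ne' (by linarith))).smul_add_smul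
      (hC' (mul_left_cancel₀ hβ.ne' (by linarith))) α β

theorem headSum_eq_of_apply_eq {n : ℕ} {x a : Fin n → ℝ} (hx : Antitone x) (ha : Antitone a)
    (hle : ∀ k, headSum k a ≤ headSum k x) {p q : Fin n} (hpq : (p : ℕ) + 1 = q)
    (hq : headSum q a = headSum q x) (hapq : a p = a q) {j : Fin n} (hj : a j = a p) :
    headSum j a = headSum j x ∧ headSum (j + 1) a = headSum (j + 1) x := by
  have ha' := fun i => headSum_succ a i
  have hx' := fun i => headSum_succ x i
  have hxpq : x q ≤ x p := hx (Fin.le_def.2 (by omega))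
  have hp1 := ha' p
  have hp2 := hx' p
  rw [hpq] at hp1 hp2
  have hxp : x p = a p := by linarith [hle p, hle (q + 1), ha' q, hx' q]
  have hxq : x q = a p := by linarith [hle p, hle (q + 1), ha' q, hx' q]
  have hdown : ∀ m : ℕ, ∀ j : Fin n, (j : ℕ) + m = p → a j = a p →
      headSum j a = headSum j x := by
    intro m
    induction m with
    | zero =>
      intro j hjp _
      obtain rfl : j = p := Fin.ext (by omega)
      linarith
    | succ m ih =>
      intro j hjp haj
      let j' : Fin n := ⟨j + 1, by omega⟩
      have h1 : a j' ≤ a j := ha (Fin.le_def.2 (by simp [j']))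
      have h2 : a p ≤ a j' := ha (Fin.le_def.2 (by simp [j']; omega))
      have h3 : headSum (j + 1) a = headSum (j + 1) x :=
        ih j' (by simp only [j']; omega) (by linarith)
      have h4 : x p ≤ x j := hx (Fin.le_def.2 (by omega))
      linarith [ha' j, hx' j, hle j]
  have hup : ∀ m : ℕ, ∀ j : Fin n, (j : ℕ) = q + m → a j = a p →
      headSum (j + 1) a = headSum (j + 1) x := by
    intro m
    induction m with
    | zero =>
      intro j hjq haj
      obtain rfl : j = q := Fin.ext (by omega)
      linarith [ha' j, hx' j]
    | succ m ih =>
      intro j hjq haj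
      let j' : Fin n := ⟨j - 1, by omega⟩
      have h1 : a j ≤ a j' := ha (Fin.le_def.2 (by simp [j']))
      have h2 : a j' ≤ a q := ha (Fin.le_def.2 (by simp only [j']; omega))
      have h3 := ih j' (by simp only [j']; omega) (by linarith)
      rw [show (j' : ℕ) + 1 = j by simp only [j']; omega] at h3
      have h4 : x j ≤ x q := hx (Fin.le_def.2 (by omega))
      linarith [ha' j, hx' j, hle (j + 1)]
  rcases lt_or_ge (j : ℕ) q with h | h
  · have hj1 := hdown (p - j) j (by omega) hj
    refine ⟨hj1, ?_⟩
    rcases (show (j : ℕ) ≤ p by omega).eq_or_lt with hjp | hjp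
    · rwa [hjp, hpq]
    · exact hdown (p - (j + 1)) ⟨j + 1, by omega⟩ (by simp only; omega)
        (le_antisymm ((ha (Fin.le_def.2 (by simp))).trans_eq hj)
          (ha (Fin.le_def.2 (by simp only; omega))))
  · have hj1 := hup (j - q) j (by omega) hj
    refine ⟨?_, hj1⟩
    rcases h.eq_or_lt with hjq | hjq
    · rwa [← hjq]
    · have := hup (j - 1 - q) ⟨j - 1, by omega⟩ (by simp only; omega)
        (le_antisymm ((ha (Fin.le_def.2 (by simp only; omega))).trans_eq hapq.symm)
          (hj.symm.trans_le (ha (Fin.le_def.2 (by simp)))))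
      rwa [show ((⟨j - 1, by omega⟩ : Fin n) : ℕ) + 1 = j by simp only; omega] at this

theorem Antitone.exists_strict_separation_or {n : ℕ} {a : Fin n → ℝ} (ha : Antitone a) (k : ℕ) :
    (∃ t, (∀ i : Fin n, (i : ℕ) < k → t < a i) ∧ ∀ i : Fin n, k ≤ i → a i < t) ∨
      ∃ p q : Fin n, (p : ℕ) + 1 = q ∧ (q : ℕ) = k ∧ a p = a q := by
  rcases k.eq_zero_or_pos with rfl | hk
  · refine .inl ⟨∑ i, |a i| + 1, fun i hi => absurd hi (by omega), fun i _ => ?_⟩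
    have := single_le_sum (f := fun i => |a i|) (fun i _ => abs_nonneg _) (mem_univ i)
    linarith [le_abs_self (a i)]
  rcases le_or_gt n k with hnk | hkn
  · refine .inl ⟨-∑ i, |a i| - 1, fun i _ => ?_, fun i hi => absurd i.isLt (by omega)⟩
    have := single_le_sum (f := fun i => |a i|) (fun i _ => abs_nonneg _) (mem_univ i)
    linarith [neg_abs_le (a i)]
  let p : Fin n := ⟨k - 1, by omega⟩
  let q : Fin n := ⟨k, hkn⟩
  have hle : a q ≤ a p := ha (Fin.le_def.2 (by simp [p, q]))
  rcases hle.eq_or_lt with h | h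
  · exact .inr ⟨p, q, by simp only [p, q]; omega, rfl, h.symm⟩
  · refine .inl ⟨(a p + a q) / 2, fun i hi => ?_, fun i hi => ?_⟩
    · have : a p ≤ a i := ha (Fin.le_def.2 (by simp only [p]; omega))
      linarith
    · have : a i ≤ a q := ha (Fin.le_def.2 hi)
      linarith

theorem exists_pos_le_abs_sub {n : ℕ} (a : Fin n → ℝ) (t : ℝ) :
    ∃ δ > 0, ∀ i, a i ≠ t → δ ≤ |a i - t| := by
  have h : ∀ i, ∀ᶠ δ in 𝓝[>] (0 : ℝ), a i ≠ t → δ ≤ |a i - t| := fun i => by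
    by_cases hi : a i = t
    · simp [hi]
    · filter_upwards [Ioc_mem_nhdsGT (abs_pos.2 (sub_ne_zero.2 hi))] with δ hδ _ using hδ.2
  obtain ⟨δ, hδ, h0⟩ := ((eventually_all.2 h).and self_mem_nhdsWithin).exists
  exact ⟨δ, h0, hδ⟩

/-- The quadratic form of a small matrix vanishing on the rows and columns where `a` equals `t` is
dominated by that of `|diagonal a - t|`. -/
theorem abs_dotProduct_perturbation_le {n : ℕ} {a : Fin n → ℝ} {t δ ε : ℝ}
    (hδ : ∀ i, a i ≠ t → δ ≤ |a i - t|) {C : Matrix (Fin n) (Fin n) ℝ}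
    (hC : ∀ i j, a i = t ∨ a j = t → C i j = 0) (hε : 0 ≤ ε)
    (hεδ : ε * ∑ i, ∑ j, |C i j| ≤ δ) (v : Fin n → ℝ) :
    |v ⬝ᵥ (ε • C) *ᵥ v| ≤ ∑ i, |a i - t| * v i ^ 2 := by
  let u : Fin n → ℝ := fun i => if a i = t then 0 else v i
  have huv : v ⬝ᵥ C *ᵥ v = u ⬝ᵥ C *ᵥ u := by
    rw [dotProduct_mulVec_eq_sum, dotProduct_mulVec_eq_sum]
    refine sum_congr rfl fun i _ => sum_congr rfl fun j _ => ?_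
    by_cases h : a i = t ∨ a j = t
    · simp [hC i j h]
    · rw [not_or] at h
      simp [u, h]
  rw [smul_mulVec, dotProduct_smul, smul_eq_mul, abs_mul, abs_of_nonneg hε, huv]
  calc ε * |u ⬝ᵥ C *ᵥ u| ≤ ε * ((∑ i, ∑ j, |C i j|) * (u ⬝ᵥ u)) :=
        mul_le_mul_of_nonneg_left (abs_dotProduct_mulVec_le C u) hε
    _ ≤ δ * (u ⬝ᵥ u) := by
        rw [← mul_assoc]
        exact mul_le_mul_of_nonneg_right hεδ (sum_nonneg fun i _ => mul_self_nonneg _)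
    _ ≤ ∑ i, |a i - t| * v i ^ 2 := by
        rw [dotProduct, mul_sum]
        refine sum_le_sum fun i _ => ?_
        by_cases h : a i = t
        · simp [u, h]
        · simp only [u, if_neg h, ← sq]
          exact mul_le_mul_of_nonneg_right (hδ i h) (sq_nonneg _)

theorem eventually_headSum_conj_le_of_isBlockAt {n k : ℕ} {a : Fin n → ℝ} {t : ℝ}
    (h1 : ∀ i : Fin n, (i : ℕ) < k → t ≤ a i) (h2 : ∀ i : Fin n, k ≤ i → a i ≤ t)
    {C : Matrix (Fin n) (Fin n) ℝ} (hCk : IsBlockAt k C)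
    (hC : ∀ i j, a i = t ∨ a j = t → C i j = 0) :
    ∀ᶠ ε in 𝓝[>] (0 : ℝ), ∀ g ∈ orthogonalGroup (Fin n) ℝ,
      headSum k (g * (diagonal a + ε • C) * gᵀ).diag ≤ headSum k (diagonal a + ε • C).diag := by
  obtain ⟨δ, hδ, hδa⟩ := exists_pos_le_abs_sub a t
  have hsmall : ∀ᶠ ε in 𝓝[>] (0 : ℝ), ε * ∑ i, ∑ j, |C i j| < δ := by
    refine Tendsto.eventually_lt_const hδ (tendsto_nhdsWithin_of_tendsto_nhds ?_)
    have : Continuous fun ε : ℝ => ε * ∑ i, ∑ j, |C i j| := by fun_prop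
    simpa using this.tendsto 0
  filter_upwards [hsmall, self_mem_nhdsWithin] with ε hε hε0 g hg
  have hblock : IsBlockAt k (diagonal a + ε • C) := by
    simpa using (isBlockAt_diagonal k a).smul_add_smul hCk 1 ε
  have hexp : ∀ v : Fin n → ℝ, v ⬝ᵥ (diagonal a + ε • C - t • 1) *ᵥ v
      = ∑ i, (a i - t) * v i ^ 2 + v ⬝ᵥ (ε • C) *ᵥ v := fun v => by
    rw [add_sub_right_comm, add_mulVec, dotProduct_add, diagonal_sub_dotProduct_mulVec]
  have hbound := abs_dotProduct_perturbation_le hδa hC (le_of_lt hε0) hε.le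
  refine hblock.headSum_conj_diag_le t (fun v => ?_) (fun v => ?_) hg
  · rw [hexp]
    have heq : ∑ i, |a i - t| * headPart k v i ^ 2 = ∑ i, (a i - t) * headPart k v i ^ 2 :=
      sum_congr rfl fun i _ => by
        by_cases hi : (i : ℕ) < k
        · rw [abs_of_nonneg (sub_nonneg.2 (h1 i hi))]
        · simp [headPart, hi]
    linarith [(abs_le.1 (hbound (headPart k v))).1]
  · rw [hexp]
    have heq : ∑ i, |a i - t| * tailPart k v i ^ 2 = -∑ i, (a i - t) * tailPart k v i ^ 2 := by
      rw [← sum_neg_distrib]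
      refine sum_congr rfl fun i _ => ?_
      by_cases hi : (i : ℕ) < k
      · simp [tailPart, hi]
      · rw [abs_of_nonpos (sub_nonpos.2 (h2 i (not_lt.1 hi))), neg_mul]
    linarith [(abs_le.1 (hbound (tailPart k v))).2]

theorem headSum_conj_diag_le_sum_abs {n : ℕ} (k : ℕ) (C : Matrix (Fin n) (Fin n) ℝ)
    {g : Matrix (Fin n) (Fin n) ℝ} (hg : g ∈ orthogonalGroup (Fin n) ℝ) :
    headSum k (g * C * gᵀ).diag ≤ n * ∑ i, ∑ j, |C i j| := by
  have hrow : ∀ i, (g * C * gᵀ).diag i ≤ ∑ i, ∑ j, |C i j| := fun i => by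
    have hgi : g i ⬝ᵥ g i = 1 := by
      simpa [Matrix.mul_apply, dotProduct] using
        congr_fun₂ ((mem_orthogonalGroup_iff _ _).1 hg) i i
    rw [conj_diag_apply]
    refine (le_abs_self _).trans ((abs_dotProduct_mulVec_le C (g i)).trans ?_)
    rw [hgi, mul_one]
  refine (sum_le_card_nsmul _ _ _ fun i _ => hrow i).trans ?_
  rw [nsmul_eq_mul]
  refine mul_le_mul_of_nonneg_right ?_ (sum_nonneg fun i _ => sum_nonneg fun j _ => abs_nonneg _)
  exact_mod_cast (card_le_univ _).trans_eq (Fintype.card_fin n)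

theorem exists_prolongation_mem_orbitope {n : ℕ} {x a : Fin n → ℝ} (hx : Antitone x)
    (ha : Antitone a) (hA : diagonal a ∈ orbitope x) {B : Matrix (Fin n) (Fin n) ℝ}
    (hB : B ∈ orbitope x)
    (htight : ∀ k ≤ n, headSum k a = headSum k x → headSum k B.diag = headSum k x) :
    ∃ ε : ℝ, 0 < ε ∧ diagonal a + ε • (diagonal a - B) ∈ orbitope x := by
  have hle : ∀ k, headSum k a ≤ headSum k x := fun k => by
    simpa using (headSum_diag_le_of_mem_orbitope hx k hA).1
  have hblock : ∀ k ≤ n, headSum k a = headSum k x → IsBlockAt k (diagonal a - B) := by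
    intro k hk h
    have := (isBlockAt_diagonal k a).smul_add_smul
      ((headSum_diag_le_of_mem_orbitope hx k hB).2 (htight k hk h)) 1 (-1)
    simpa [sub_eq_add_neg] using this
  have hev : ∀ k ∈ range (n + 1), ∀ᶠ ε in 𝓝[>] (0 : ℝ), ∀ g ∈ orthogonalGroup (Fin n) ℝ,
      headSum k (g * (diagonal a + ε • (diagonal a - B)) * gᵀ).diag ≤ headSum k x := by
    intro k hk
    have hk : k ≤ n := by simpa [Nat.lt_succ_iff] using hk
    rcases (hle k).lt_or_eq with h | h
    · have hsmall : ∀ᶠ ε in 𝓝[>] (0 : ℝ),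
          headSum k a + ε * (n * ∑ i, ∑ j, |(diagonal a - B) i j|) < headSum k x := by
        refine Tendsto.eventually_lt_const h (tendsto_nhdsWithin_of_tendsto_nhds ?_)
        have : Continuous fun ε : ℝ =>
          headSum k a + ε * (n * ∑ i, ∑ j, |(diagonal a - B) i j|) := by fun_prop
        simpa using this.tendsto 0
      filter_upwards [hsmall, self_mem_nhdsWithin] with ε hε hε0 g hg
      have h1 := (ha.headSum_conj_diagonal_le k hg).1
      have h2 := mul_le_mul_of_nonneg_left
        (headSum_conj_diag_le_sum_abs k (diagonal a - B) hg) (le_of_lt hε0)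
      rw [Matrix.mul_add, Matrix.add_mul, Matrix.mul_smul, Matrix.smul_mul, diag_add, diag_smul,
        headSum_add, headSum_smul]
      linarith
    · have hdiag : ∀ ε : ℝ,
          headSum k (diagonal a + ε • (diagonal a - B)).diag = headSum k x := fun ε => by
        have hsub : headSum k (diagonal a - B).diag = 0 := by
          have := headSum_add k (diagonal a - B).diag B.diag
          rw [← diag_add, sub_add_cancel, diag_diagonal] at this
          linarith [htight k hk h]
        rw [diag_add, diag_smul, headSum_add, headSum_smul, hsub, diag_diagonal, h]
        ring
      suffices hsep : ∃ t, (∀ i : Fin n, (i : ℕ) < k → t ≤ a i) ∧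
          (∀ i : Fin n, k ≤ i → a i ≤ t) ∧
          ∀ i j, a i = t ∨ a j = t → (diagonal a - B) i j = 0 by
        obtain ⟨t, h1, h2, h3⟩ := hsep
        filter_upwards [eventually_headSum_conj_le_of_isBlockAt h1 h2 (hblock k hk h) h3]
          with ε hε g hg
        exact (hε g hg).trans_eq (hdiag ε)
      rcases ha.exists_strict_separation_or k with ⟨t, h1, h2⟩ | ⟨p, q, hpq, rfl, hapq⟩
      · refine ⟨t, fun i hi => (h1 i hi).le, fun i hi => (h2 i hi).le, fun i j hij => ?_⟩
        have hne : ∀ i, a i ≠ t := fun i => by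
          rcases lt_or_ge (i : ℕ) k with hi | hi
          · exact (h1 i hi).ne'
          · exact (h2 i hi).ne
        exact (hij.elim (hne i) (hne j)).elim
      · have hz : ∀ i j, a j = a p → (diagonal a - B) i j = 0 ∧ (diagonal a - B) j i = 0 := by
          intro i j hj
          obtain ⟨hj1, hj2⟩ := headSum_eq_of_apply_eq hx ha hle hpq h hapq hj
          have hjn := j.isLt
          rcases lt_trichotomy (i : ℕ) j with hij | hij | hij
          · exact hblock j hjn.le hj1 i j hij le_rfl
          · obtain rfl := Fin.ext hij
            have hB1 := htight i hjn.le hj1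
            have hB2 := htight (i + 1) hjn hj2
            rw [headSum_succ] at hB2 hj2
            have : B i i = a i := by
              rw [diag_apply] at hB2
              linarith
            simp [this]
          · exact (hblock (j + 1) hjn hj2 j i (by omega) hij).symm
        refine ⟨a p, fun i hi => ha (Fin.le_def.2 (by omega)),
          fun i hi => hapq ▸ ha (Fin.le_def.2 hi), fun i j hij => ?_⟩
        exact hij.elim (fun hi => (hz j i hi).2) fun hj => (hz i j hj).1
  obtain ⟨ε, hε, hε0⟩ :=
    (((range (n + 1)).eventually_all.2 hev).and self_mem_nhdsWithin).exists
  refine ⟨ε, hε0, mem_orbitope_of_headSum_le ?_ ?_ fun g hg k hk =>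
    hε k (by simpa [Nat.lt_succ_iff] using hk) g hg⟩
  · have h1 := isHermitian_of_mem_orbitope hA
    have h2 := isHermitian_of_mem_orbitope hB
    exact h1.add (by
      rw [IsHermitian, conjTranspose_smul, (h1.sub h2).eq]
      simp)
  · rw [trace_add, trace_smul, trace_sub, trace_of_mem_orbitope hA, trace_of_mem_orbitope hB]
    simp

/-- The sum of the first `k` diagonal entries of `uᵀ * B * u`, as a linear functional of `B`. -/
def conjHeadTrace {n : ℕ} (u : Matrix (Fin n) (Fin n) ℝ) (k : ℕ) :
    Matrix (Fin n) (Fin n) ℝ →ₗ[ℝ] ℝ where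
  toFun B := headSum k (uᵀ * B * u).diag
  map_add' B C := by rw [Matrix.mul_add, Matrix.add_mul, diag_add, headSum_add]
  map_smul' r B := by
    rw [Matrix.mul_smul, Matrix.smul_mul, diag_smul, headSum_smul, RingHom.id_apply, smul_eq_mul]

/-- Every point `A` of the orbitope has a supporting functional whose face contains `A` in its
relative interior. -/
theorem exists_supporting_functional {n : ℕ} {x : Fin n → ℝ} (hx : Antitone x)
    {A : Matrix (Fin n) (Fin n) ℝ} (hA : A ∈ orbitope x) :
    ∃ l : Matrix (Fin n) (Fin n) ℝ →ₗ[ℝ] ℝ, (∀ B ∈ orbitope x, l B ≤ l A) ∧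
      ∀ B ∈ orbitope x, l B = l A → ∃ ε : ℝ, 0 < ε ∧ A + ε • (A - B) ∈ orbitope x := by
  obtain ⟨u, hu, a, ha, rfl⟩ := exists_orthogonal_diagonalization (isHermitian_of_mem_orbitope hA)
  have huu := (mem_orthogonalGroup_iff' _ _).1 hu
  have huu' := (mem_orthogonalGroup_iff _ _).1 hu
  have hconj : ∀ B ∈ orbitope x, uᵀ * B * u ∈ orbitope x := fun B hB => by
    simpa using conj_mem_orbitope (transpose_mem_orthogonalGroup hu) hB
  have hcancel : uᵀ * (u * diagonal a * uᵀ) * u = diagonal a := by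
    simp only [Matrix.mul_assoc, huu, Matrix.mul_one]
    rw [← Matrix.mul_assoc, huu, Matrix.one_mul]
  let I := (range (n + 1)).filter fun k => headSum k a = headSum k x
  have hA' : ∀ k, conjHeadTrace u k (u * diagonal a * uᵀ) = headSum k a := fun k => by
    change headSum k (uᵀ * (u * diagonal a * uᵀ) * u).diag = _
    rw [hcancel, diag_diagonal]
  have hle : ∀ B ∈ orbitope x, ∀ k ∈ I,
      conjHeadTrace u k B ≤ conjHeadTrace u k (u * diagonal a * uᵀ) := by
    intro B hB k hk
    rw [hA', (mem_filter.1 hk).2]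
    exact (headSum_diag_le_of_mem_orbitope hx k (hconj B hB)).1
  refine ⟨∑ k ∈ I, conjHeadTrace u k, fun B hB => ?_, fun B hB h => ?_⟩
  · simp only [LinearMap.sum_apply]
    exact sum_le_sum (hle B hB)
  · simp only [LinearMap.sum_apply] at h
    have htight := (sum_eq_sum_iff_of_le (hle B hB)).1 h
    obtain ⟨ε, hε, hmem⟩ := exists_prolongation_mem_orbitope hx ha
      (hcancel ▸ hconj _ hA) (hconj B hB) fun k hk hka => by
        have := htight k (mem_filter.2 ⟨mem_range.2 (Nat.lt_succ_of_le hk), hka⟩)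
        rw [hA', hka] at this
        exact this
    refine ⟨ε, hε, ?_⟩
    have := conj_mem_orbitope hu hmem
    have hBB : u * (uᵀ * B * u) * uᵀ = B := by
      simp only [Matrix.mul_assoc, huu', Matrix.mul_one]
      rw [← Matrix.mul_assoc, huu', Matrix.one_mul]
    rwa [Matrix.mul_add, Matrix.add_mul, Matrix.mul_smul, Matrix.smul_mul, Matrix.mul_sub,
      Matrix.sub_mul, hBB] at this

/-- every face of the symmetric Schur–Horn orbitope
`O_X = convexHull {g X gᵀ : g ∈ O(n)}` (for `X` real symmetric) is exposed. -/
theorem schurHorn_orbitope_faces_exposed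
    {n : ℕ} (X : Matrix (Fin n) (Fin n) ℝ) (hX : X.IsHermitian)
    (F : Set (Matrix (Fin n) (Fin n) ℝ)) (hFconv : Convex ℝ F)
    (hF : IsExtreme ℝ (convexHull ℝ {m : Matrix (Fin n) (Fin n) ℝ |
        ∃ g ∈ Matrix.orthogonalGroup (Fin n) ℝ, m = g * X * gᵀ}) F) :
    IsExposed ℝ (convexHull ℝ {m : Matrix (Fin n) (Fin n) ℝ |
        ∃ g ∈ Matrix.orthogonalGroup (Fin n) ℝ, m = g * X * gᵀ}) F := by
  intro hne
  obtain ⟨w, hw, x, hx, rfl⟩ := exists_orthogonal_diagonalization hX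
  have horb : convexHull ℝ {m : Matrix (Fin n) (Fin n) ℝ |
      ∃ g ∈ Matrix.orthogonalGroup (Fin n) ℝ, m = g * (w * diagonal x * wᵀ) * gᵀ}
      = orbitope x := by
    congr 1
    ext m
    constructor
    · rintro ⟨g, hg, rfl⟩
      exact ⟨g * w, mul_mem hg hw, by simp [Matrix.mul_assoc]⟩
    · rintro ⟨g, hg, rfl⟩
      refine ⟨g * wᵀ, mul_mem hg (transpose_mem_orthogonalGroup hw), ?_⟩
      have hww := (mem_orthogonalGroup_iff' _ _).1 hw
      simp only [transpose_mul, transpose_transpose, Matrix.mul_assoc]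
      simp only [← Matrix.mul_assoc wᵀ w, hww, Matrix.one_mul]
  rw [horb] at hF ⊢
  let _ : NormedAddCommGroup (Matrix (Fin n) (Fin n) ℝ) := Matrix.normedAddCommGroup
  let _ : NormedSpace ℝ (Matrix (Fin n) (Fin n) ℝ) := Matrix.normedSpace
  obtain ⟨A, hAF, hA⟩ := hFconv.exists_forall_add_smul_sub_mem hne
  obtain ⟨l, hl, hl'⟩ := exists_supporting_functional hx (hF.subset hAF)
  refine ⟨l.toContinuousLinearMap, Set.Subset.antisymm (fun B hB => ⟨hF.subset hB, ?_⟩) ?_⟩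
  · obtain ⟨ε, hε, hmem⟩ := hA B hB
    have h1 := hl _ (hF.subset hmem)
    rw [map_add, map_smul, map_sub, smul_eq_mul] at h1
    have h2 : l A ≤ l B := by nlinarith
    exact fun C hC => (hl C hC).trans h2
  · rintro B ⟨hB, hBmax⟩
    obtain ⟨ε, hε, hmem⟩ := hl' B hB (le_antisymm (hl B hB) (hBmax A (hF.subset hAF)))
    refine hF.left_mem_of_mem_openSegment hB hmem hAF
      ⟨ε / (1 + ε), 1 / (1 + ε), by positivity, by positivity, by field_simp; ring, ?_⟩
    rw [smul_add, smul_smul, smul_sub, ← sub_eq_zero]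
    have : (1 + ε) ≠ 0 := by positivity
    match_scalars <;> field_simp <;> ring
end

section
/- Let X be a real diagonal n×n matrix, O_X := convexHull{g X gᵀ : g ∈ O(n)}, Π_X := convexHull{σ·X : σ ∈ S_n}, and P the linear map on n×n real matrices that sets all off-diagonal entries to zero. Let f and f' be faces of Π_X, set F := P⁻¹(f) ∩ O_X and F' := P⁻¹(f') ∩ O_X, and suppose there exists k ∈ O(n) with F' = {k Y kᵀ : Y ∈ F}. Then there exists σ ∈ S_n with f' = {σ·D : D ∈ f}. -/
open Matrix

/-- The linear operation on `n × n` real matrices that sets all off-diagonal entries to zero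
(orthogonal projection onto the subspace of diagonal matrices). -/
def diagPart {n : ℕ} (A : Matrix (Fin n) (Fin n) ℝ) : Matrix (Fin n) (Fin n) ℝ :=
  Matrix.diagonal (fun i => A i i)

/-- The action of a permutation `σ` on matrices: `(σ · A) i j = A (σ⁻¹ i) (σ⁻¹ j)`.
On a diagonal matrix this makes the `i`-th diagonal entry the `σ⁻¹ i`-th one of `A`. -/
def permAct {n : ℕ} (σ : Equiv.Perm (Fin n)) (A : Matrix (Fin n) (Fin n) ℝ) :
    Matrix (Fin n) (Fin n) ℝ :=
  A.submatrix ⇑σ⁻¹ ⇑σ⁻¹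

/-- Every point that carries positive weight in a convex combination lying in an extreme subset
belongs to that subset. -/
theorem IsExtreme.mem_of_sum_mem {E κ : Type*} [AddCommGroup E] [Module ℝ E] {A B : Set E}
    (hA : Convex ℝ A) (hB : IsExtreme ℝ A B) {t : Finset κ} {w : κ → ℝ} {z : κ → E}
    (hw : ∀ i ∈ t, 0 ≤ w i) (hw1 : ∑ i ∈ t, w i = 1) (hz : ∀ i ∈ t, z i ∈ A)
    (hsum : ∑ i ∈ t, w i • z i ∈ B) {i : κ} (hi : i ∈ t) (hwi : 0 < w i) : z i ∈ B := by
  classical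
  rw [← Finset.add_sum_erase t _ hi] at hw1 hsum
  have hw0 : ∀ j ∈ t.erase i, 0 ≤ w j := fun j hj => hw j (Finset.mem_of_mem_erase hj)
  obtain h0 | hpos := (Finset.sum_nonneg hw0).eq_or_lt
  · have hrest : ∑ j ∈ t.erase i, w j • z j = 0 :=
      Finset.sum_eq_zero fun j hj => by
        rw [(Finset.sum_eq_zero_iff_of_nonneg hw0).1 h0.symm j hj, zero_smul]
    have hwi1 : w i = 1 := by linarith
    simpa [hrest, hwi1] using hsum
  · refine hB.left_mem_of_mem_openSegment (hz i hi)
      (hA.centerMass_mem hw0 hpos fun j hj => hz j (Finset.mem_of_mem_erase hj)) hsum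
      ⟨w i, ∑ j ∈ t.erase i, w j, hwi, hpos, hw1, ?_⟩
    rw [Finset.centerMass, smul_inv_smul₀ hpos.ne']

/-- Two finite families with the same multiset of values differ by a permutation of the index. -/
theorem exists_perm_comp_eq_of_map_univ_eq {ι α : Type*} [Fintype ι] {a b : ι → α}
    (h : Finset.univ.val.map a = Finset.univ.val.map b) :
    ∃ σ : Equiv.Perm ι, b ∘ σ = a := by
  classical
  have hcard : ∀ c, Fintype.card {i // a i = c} = Fintype.card {i // b i = c} := by
    intro c
    have hc := congrArg (Multiset.count c) h
    rw [Multiset.count_map, Multiset.count_map] at hc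
    rw [Fintype.card_subtype, Fintype.card_subtype]
    simpa [Finset.card_def, Finset.filter_val, eq_comm] using hc
  exact ⟨Equiv.ofFiberEquiv fun c => Fintype.equivOfCardEq (hcard c),
    funext fun i => Equiv.ofFiberEquiv_map _ i⟩

section Permutohedron

variable {ι : Type*}

/-- The permutohedron of `d`: the convex hull of all rearrangements of `d`. -/
def permutohedron (d : ι → ℝ) : Set (ι → ℝ) :=
  convexHull ℝ (Set.range fun σ : Equiv.Perm ι => d ∘ σ)

theorem convex_permutohedron (d : ι → ℝ) : Convex ℝ (permutohedron d) :=
  convex_convexHull ℝ _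

theorem comp_perm_mem_permutohedron (d : ι → ℝ) (σ : Equiv.Perm ι) : d ∘ σ ∈ permutohedron d :=
  subset_convexHull ℝ _ ⟨σ, rfl⟩

theorem permutohedron.comp_mem {d y : ι → ℝ} (hy : y ∈ permutohedron d) (τ : Equiv.Perm ι) :
    y ∘ τ ∈ permutohedron d := by
  have himage : LinearMap.funLeft ℝ ℝ τ '' permutohedron d ⊆ permutohedron d := by
    rw [permutohedron, LinearMap.image_convexHull]
    refine convexHull_mono ?_
    rintro _ ⟨_, ⟨σ, rfl⟩, rfl⟩
    exact ⟨σ * τ, rfl⟩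
  exact himage ⟨y, hy, rfl⟩

theorem IsExtreme.comp_preimage {d : ι → ℝ} {g : Set (ι → ℝ)}
    (hg : IsExtreme ℝ (permutohedron d) g) (τ : Equiv.Perm ι) :
    IsExtreme ℝ (permutohedron d) ((fun y => y ∘ τ) ⁻¹' g) where
  subset y hy := by
    have h := permutohedron.comp_mem (hg.subset hy) τ⁻¹
    have heq : (y ∘ τ) ∘ ⇑τ⁻¹ = y := by ext i; simp
    rwa [heq] at h
  left_mem_of_mem_openSegment x hx y hy z hz hseg := by
    refine hg.left_mem_of_mem_openSegment (permutohedron.comp_mem hx τ)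
      (permutohedron.comp_mem hy τ) hz ?_
    obtain ⟨a, b, ha, hb, hab, rfl⟩ := hseg
    exact ⟨a, b, ha, hb, hab, rfl⟩

theorem Convex.comp_preimage {g : Set (ι → ℝ)} (hg : Convex ℝ g) (τ : Equiv.Perm ι) :
    Convex ℝ ((fun y => y ∘ τ) ⁻¹' g) :=
  hg.linear_preimage (LinearMap.funLeft ℝ ℝ τ)

variable [Fintype ι] [DecidableEq ι]

open Classical in
/-- The permutations sending `d` into the set `g`. -/
noncomputable def permsInto (d : ι → ℝ) (g : Set (ι → ℝ)) : Finset (Equiv.Perm ι) :=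
  {σ | d ∘ σ ∈ g}

theorem mem_permsInto {d : ι → ℝ} {g : Set (ι → ℝ)} {σ : Equiv.Perm ι} :
    σ ∈ permsInto d g ↔ d ∘ σ ∈ g := by
  simp [permsInto]

/-- The average of the rearrangements of `d` that lie in `g`. -/
noncomputable def orbitBarycenter (d : ι → ℝ) (g : Set (ι → ℝ)) : ι → ℝ :=
  ∑ σ ∈ permsInto d g, ((permsInto d g).card : ℝ)⁻¹ • (d ∘ σ)

variable {d : ι → ℝ} {g : Set (ι → ℝ)}

theorem mem_convexHull_vertices (hg : IsExtreme ℝ (permutohedron d) g) {y : ι → ℝ} (hy : y ∈ g) :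
    y ∈ convexHull ℝ ((fun σ : Equiv.Perm ι => d ∘ σ) '' permsInto d g) := by
  classical
  obtain ⟨κ, _, w, z, hw, hw1, hz, rfl⟩ :=
    mem_convexHull_iff_exists_fintype.1 (hg.subset hy)
  rw [← Fintype.sum_subset (s := {i | w i ≠ 0})
    fun i hi => Finset.mem_filter.2 ⟨Finset.mem_univ _, left_ne_zero_of_smul hi⟩]
  refine (convex_convexHull ℝ _).sum_mem (fun i _ => hw i) (by rwa [Finset.sum_filter_ne_zero])
    fun i hi => subset_convexHull ℝ _ ?_
  obtain ⟨σ, hσ⟩ := hz i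
  refine ⟨σ, mem_permsInto.2 ?_, hσ⟩
  have hmem : z i ∈ g := hg.mem_of_sum_mem (convex_permutohedron d) (fun j _ => hw j) hw1
    (fun j _ => subset_convexHull ℝ _ (hz j)) hy (Finset.mem_univ i)
    ((hw i).lt_of_ne' (Finset.mem_filter.1 hi).2)
  rwa [← hσ] at hmem

theorem permsInto_nonempty (hg : IsExtreme ℝ (permutohedron d) g) (hne : g.Nonempty) :
    (permsInto d g).Nonempty := by
  obtain ⟨y, hy⟩ := hne
  have h := convexHull_nonempty_iff.1 ⟨y, mem_convexHull_vertices hg hy⟩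
  simpa using h

theorem sum_inv_card_permsInto (hg : IsExtreme ℝ (permutohedron d) g) (hne : g.Nonempty) :
    ∑ _σ ∈ permsInto d g, ((permsInto d g).card : ℝ)⁻¹ = 1 := by
  have : ((permsInto d g).card : ℝ) ≠ 0 := by
    exact_mod_cast (permsInto_nonempty hg hne).card_pos.ne'
  simp [this]

theorem orbitBarycenter_mem (hconv : Convex ℝ g) (hg : IsExtreme ℝ (permutohedron d) g)
    (hne : g.Nonempty) : orbitBarycenter d g ∈ g :=
  hconv.sum_mem (fun _ _ => by positivity) (sum_inv_card_permsInto hg hne)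
    fun _ hσ => mem_permsInto.1 hσ

/-- The barycenter of a face of the permutohedron lies in its relative interior: every face
that contains it contains the whole face. -/
theorem subset_of_orbitBarycenter_mem (hg : IsExtreme ℝ (permutohedron d) g) (hne : g.Nonempty)
    {h : Set (ι → ℝ)} (hconv : Convex ℝ h) (hh : IsExtreme ℝ (permutohedron d) h)
    (hmem : orbitBarycenter d g ∈ h) : g ⊆ h := by
  intro y hy
  refine convexHull_min ?_ hconv (mem_convexHull_vertices hg hy)
  rintro _ ⟨σ, hσ, rfl⟩
  have hpos : (0 : ℝ) < ((permsInto d g).card : ℝ)⁻¹ :=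
    inv_pos.2 (by exact_mod_cast (permsInto_nonempty hg hne).card_pos)
  exact hh.mem_of_sum_mem (convex_permutohedron d) (fun _ _ => hpos.le)
    (sum_inv_card_permsInto hg hne) (fun τ _ => comp_perm_mem_permutohedron d τ) hmem hσ hpos

theorem orbitBarycenter_comp (s : Equiv.Perm ι) (hs : ∀ σ ∈ permsInto d g, σ * s ∈ permsInto d g) :
    orbitBarycenter d g ∘ s = orbitBarycenter d g := by
  have hcomp : orbitBarycenter d g ∘ s =
      ∑ σ ∈ permsInto d g, ((permsInto d g).card : ℝ)⁻¹ • (d ∘ ⇑(σ * s)) := by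
    ext i
    simp [orbitBarycenter, Finset.sum_apply]
  have himage : (permsInto d g).image (· * s) = permsInto d g :=
    Finset.eq_of_subset_of_card_le (Finset.image_subset_iff.2 hs)
      (Finset.card_image_of_injective _ (mul_left_injective s)).ge
  rw [hcomp, orbitBarycenter]
  generalize ((permsInto d g).card : ℝ)⁻¹ = c
  conv_rhs => rw [← himage]
  rw [Finset.sum_image (mul_left_injective s).injOn]

/-- Every vertex of a face of the permutohedron is sorted like the barycenter of the face. -/
theorem monovary_orbitBarycenter (hconv : Convex ℝ g) (hg : IsExtreme ℝ (permutohedron d) g)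
    {σ : Equiv.Perm ι} (hσ : σ ∈ permsInto d g) : Monovary (d ∘ σ) (orbitBarycenter d g) := by
  intro i j hij
  by_contra! hlt
  have hv : d ∘ σ ∈ g := mem_permsInto.1 hσ
  have hne : g.Nonempty := ⟨_, hv⟩
  set b := orbitBarycenter d g
  have hbg : b ∈ g := orbitBarycenter_mem hconv hg hne
  set v := d ∘ σ
  set s := Equiv.swap i j
  set p := v i - v j with hp
  set q := b j - b i with hq
  have hp0 : 0 < p := sub_pos.2 hlt
  have hq0 : 0 < q := sub_pos.2 hij
  have hpq : p + q ≠ 0 := by positivity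
  have hsymm : (p / (p + q)) • (b ∘ s) + (q / (p + q)) • (v ∘ s) =
      (p / (p + q)) • b + (q / (p + q)) • v := by
    have hvals : (p / (p + q)) * b i + (q / (p + q)) * v i =
        (p / (p + q)) * b j + (q / (p + q)) * v j := by
      field_simp
      rw [hp, hq]; ring
    ext l
    simp only [Pi.add_apply, Pi.smul_apply, Function.comp_apply, smul_eq_mul]
    obtain rfl | hli := eq_or_ne l i
    · simpa [s] using hvals.symm
    obtain rfl | hlj := eq_or_ne l j
    · simpa [s] using hvals
    · simp only [s, Equiv.swap_apply_of_ne_of_ne hli hlj]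
  have hsum1 : p / (p + q) + q / (p + q) = 1 := by field_simp
  have hmid : (p / (p + q)) • (b ∘ s) + (q / (p + q)) • (v ∘ s) ∈ g := by
    rw [hsymm]
    exact hconv hbg hv (by positivity) (by positivity) hsum1
  have hbs : b ∘ s ∈ g := hg.left_mem_of_mem_openSegment
    (permutohedron.comp_mem (hg.subset hbg) s) (permutohedron.comp_mem (hg.subset hv) s) hmid
    ⟨_, _, by positivity, by positivity, hsum1, rfl⟩
  have hfix : b ∘ s = b := orbitBarycenter_comp s fun τ hτ =>
    mem_permsInto.2 (subset_of_orbitBarycenter_mem hg hne (hconv.comp_preimage s)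
      (hg.comp_preimage s) hbs (mem_permsInto.1 hτ))
  have hbij := congrFun hfix i
  simp only [s, Function.comp_apply, Equiv.swap_apply_left] at hbij
  exact hij.ne' hbij

/-- The barycenter `b` of a face of the permutohedron is orthogonal to the face. -/
theorem orbitBarycenter_dotProduct (hconv : Convex ℝ g) (hg : IsExtreme ℝ (permutohedron d) g)
    {y : ι → ℝ} (hy : y ∈ g) :
    y ⬝ᵥ orbitBarycenter d g = orbitBarycenter d g ⬝ᵥ orbitBarycenter d g := by
  have hle : ∀ σ ∈ permsInto d g, ∀ τ : Equiv.Perm ι,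
      (d ∘ τ) ⬝ᵥ orbitBarycenter d g ≤ (d ∘ σ) ⬝ᵥ orbitBarycenter d g := by
    intro σ hσ τ
    have h := (monovary_orbitBarycenter hconv hg hσ).sum_comp_perm_mul_le_sum_mul (σ := σ⁻¹ * τ)
    simpa [dotProduct] using h
  obtain ⟨σ, hσ⟩ := permsInto_nonempty hg ⟨y, hy⟩
  have hconst : ∀ z ∈ g, z ⬝ᵥ orbitBarycenter d g = (d ∘ σ) ⬝ᵥ orbitBarycenter d g := by
    intro z hz
    have hlin : IsLinearMap ℝ fun z : ι → ℝ => z ⬝ᵥ orbitBarycenter d g :=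
      ⟨fun _ _ => add_dotProduct _ _ _, fun _ _ => smul_dotProduct _ _ _⟩
    refine convexHull_min ?_ (convex_hyperplane hlin _) (mem_convexHull_vertices hg hz)
    rintro _ ⟨τ, hτ, rfl⟩
    exact le_antisymm (hle σ hσ τ) (hle τ hτ σ)
  rw [hconst y hy, hconst _ (orbitBarycenter_mem hconv hg ⟨y, hy⟩)]

end Permutohedron

/-- Orthogonally conjugate real diagonal matrices have the same entries up to permutation. -/
theorem exists_perm_of_conj_diagonal {ι : Type*} [Fintype ι] [DecidableEq ι] {k : Matrix ι ι ℝ}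
    (hk : k ∈ Matrix.orthogonalGroup ι ℝ) {a b : ι → ℝ}
    (h : k * diagonal a * kᵀ = diagonal b) : ∃ σ : Equiv.Perm ι, b ∘ σ = a := by
  apply exists_perm_comp_eq_of_map_univ_eq
  have hk' : kᵀ * k = 1 := (mem_orthogonalGroup_iff' ι ℝ).1 hk
  have hchar : (diagonal a).charpoly = (diagonal b).charpoly := by
    rw [← h, Matrix.charpoly_mul_comm, ← Matrix.mul_assoc, hk', Matrix.one_mul]
  rw [charpoly_diagonal, charpoly_diagonal] at hchar
  have hroots := congrArg Polynomial.roots hchar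
  have hprod : ∀ c : ι → ℝ, ∏ i, (Polynomial.X - Polynomial.C (c i)) =
      ((Finset.univ.val.map c).map fun x => Polynomial.X - Polynomial.C x).prod := fun c => by
    rw [Multiset.map_map]; rfl
  rwa [hprod, hprod, Polynomial.roots_multiset_prod_X_sub_C,
    Polynomial.roots_multiset_prod_X_sub_C] at hroots

section Trace

variable {ι : Type*} [Fintype ι]

theorem trace_mul_transpose_self_nonneg (A : Matrix ι ι ℝ) : 0 ≤ (A * Aᵀ).trace := by
  simpa using (posSemidef_self_mul_conjTranspose A).trace_nonneg

theorem eq_zero_of_trace_mul_transpose_self {A : Matrix ι ι ℝ} (h : (A * Aᵀ).trace = 0) :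
    A = 0 :=
  Matrix.trace_mul_conjTranspose_self_eq_zero_iff.1 (by simpa using h)

variable [DecidableEq ι]

theorem trace_sub_diagonal_sq {Y : Matrix ι ι ℝ} {b : ι → ℝ} (h : (fun i => Y i i) ⬝ᵥ b = b ⬝ᵥ b) :
    ((Y - diagonal b) * (Y - diagonal b)ᵀ).trace = (Y * Yᵀ).trace - b ⬝ᵥ b := by
  have h1 : (Y * diagonal b).trace = b ⬝ᵥ b := by
    rw [← h]; simp [Matrix.trace, dotProduct]
  have h2 : (diagonal b * Yᵀ).trace = b ⬝ᵥ b := by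
    rw [← h]; simp [Matrix.trace, dotProduct, mul_comm]
  have h3 : (diagonal b * diagonal b).trace = b ⬝ᵥ b := by
    simp [Matrix.trace, dotProduct]
  simp only [Matrix.transpose_sub, Matrix.diagonal_transpose, Matrix.sub_mul, Matrix.mul_sub,
    Matrix.trace_sub, h1, h2, h3]
  ring

theorem trace_conj_mul_transpose {k : Matrix ι ι ℝ} (hk : k ∈ Matrix.orthogonalGroup ι ℝ)
    (A : Matrix ι ι ℝ) : ((k * A * kᵀ) * (k * A * kᵀ)ᵀ).trace = (A * Aᵀ).trace := by
  have hk' : kᵀ * k = 1 := (mem_orthogonalGroup_iff' ι ℝ).1 hk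
  have : (k * A * kᵀ) * (k * A * kᵀ)ᵀ = k * (A * Aᵀ * kᵀ) := by
    simp only [Matrix.transpose_mul, Matrix.transpose_transpose, Matrix.mul_assoc]
    rw [← Matrix.mul_assoc kᵀ k, hk', Matrix.one_mul]
  rw [this, Matrix.trace_mul_comm, Matrix.mul_assoc, hk', Matrix.mul_one]

theorem diagonal_comp_mem_orbit (d : ι → ℝ) (σ : Equiv.Perm ι) :
    ∃ g ∈ Matrix.orthogonalGroup ι ℝ, diagonal (d ∘ σ) = g * diagonal d * gᵀ := by
  have hmul : ∀ A : Matrix ι ι ℝ,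
      σ.permMatrix ℝ * A * (σ.permMatrix ℝ)ᵀ = A.submatrix σ σ := by
    intro A
    rw [Matrix.transpose_permMatrix]
    rw [Equiv.Perm.permMatrix, Equiv.Perm.permMatrix, PEquiv.toMatrix_toPEquiv_mul,
      PEquiv.mul_toMatrix_toPEquiv]
    rfl
  refine ⟨σ.permMatrix ℝ, ?_, ?_⟩
  · rw [mem_orthogonalGroup_iff]
    simpa using hmul 1
  · rw [hmul, Matrix.submatrix_diagonal_equiv]

end Trace

/-- for `X = diagonal d`, `O_X = convexHull {g X gᵀ : g ∈ O(n)}` and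
`Π_X = convexHull {σ·X : σ ∈ S_n}`, let `f, f'` be faces of `Π_X` with `F := P⁻¹(f) ∩ O_X`
and `F' := P⁻¹(f') ∩ O_X`. If `F' = {k Y kᵀ : Y ∈ F}` for some `k ∈ O(n)`, then
`f' = σ · f` for some `σ ∈ S_n`. -/
theorem exists_perm_of_conj_face
    {n : ℕ} (d : Fin n → ℝ)
    (f f' : Set (Matrix (Fin n) (Fin n) ℝ))
    (hfconv : Convex ℝ f) (hf'conv : Convex ℝ f')
    (hf : IsExtreme ℝ (convexHull ℝ {m : Matrix (Fin n) (Fin n) ℝ |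
        ∃ σ : Equiv.Perm (Fin n), m = Matrix.diagonal (fun i => d (σ⁻¹ i))}) f)
    (hf' : IsExtreme ℝ (convexHull ℝ {m : Matrix (Fin n) (Fin n) ℝ |
        ∃ σ : Equiv.Perm (Fin n), m = Matrix.diagonal (fun i => d (σ⁻¹ i))}) f')
    (k : Matrix (Fin n) (Fin n) ℝ) (hk : k ∈ Matrix.orthogonalGroup (Fin n) ℝ)
    (hconj : diagPart ⁻¹' f' ∩
          convexHull ℝ {m : Matrix (Fin n) (Fin n) ℝ |
            ∃ g ∈ Matrix.orthogonalGroup (Fin n) ℝ, m = g * Matrix.diagonal d * gᵀ} =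
        (fun Y => k * Y * kᵀ) ''
          (diagPart ⁻¹' f ∩ convexHull ℝ {m : Matrix (Fin n) (Fin n) ℝ |
            ∃ g ∈ Matrix.orthogonalGroup (Fin n) ℝ, m = g * Matrix.diagonal d * gᵀ})) :
    ∃ σ : Equiv.Perm (Fin n), f' = permAct σ '' f := by
  have hPi : convexHull ℝ {m : Matrix (Fin n) (Fin n) ℝ |
      ∃ σ : Equiv.Perm (Fin n), m = Matrix.diagonal (fun i => d (σ⁻¹ i))} =
      diagonal '' permutohedron d := by
    have himage := (diagonalLinearMap (Fin n) ℝ ℝ).image_convexHull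
      (Set.range fun σ : Equiv.Perm (Fin n) => d ∘ σ)
    refine Eq.trans (congrArg _ ?_) himage.symm
    ext m
    constructor
    · rintro ⟨σ, rfl⟩
      exact ⟨d ∘ ⇑σ⁻¹, ⟨σ⁻¹, rfl⟩, rfl⟩
    · rintro ⟨_, ⟨σ, rfl⟩, rfl⟩
      exact ⟨σ⁻¹, by rw [inv_inv]; rfl⟩
  rw [hPi] at hf hf'
  have hvec : ∀ {e : Set (Matrix (Fin n) (Fin n) ℝ)}, Convex ℝ e →
      IsExtreme ℝ (diagonal '' permutohedron d) e →
      ∃ g : Set (Fin n → ℝ), Convex ℝ g ∧ IsExtreme ℝ (permutohedron d) g ∧ e = diagonal '' g := by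
    intro e hconv he
    refine ⟨diagonal ⁻¹' e, hconv.linear_preimage (diagonalLinearMap (Fin n) ℝ ℝ), ⟨?_, ?_⟩, ?_⟩
    · intro y hy
      obtain ⟨z, hz, hzy⟩ := he.subset hy
      rwa [← diagonal_injective hzy]
    · rintro x hx y hy z hz ⟨a, b, ha, hb, hab, rfl⟩
      exact he.left_mem_of_mem_openSegment ⟨x, hx, rfl⟩ ⟨y, hy, rfl⟩ hz
        ⟨a, b, ha, hb, hab, by simp [← diagonal_smul, diagonal_add]⟩
    · rw [Set.image_preimage_eq_of_subset]
      intro y hy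
      obtain ⟨z, -, hz⟩ := he.subset hy
      exact ⟨z, hz⟩
  obtain ⟨g, hgconv, hg, rfl⟩ := hvec hfconv hf
  obtain ⟨g', hg'conv, hg', rfl⟩ := hvec hf'conv hf'
  set O := convexHull ℝ {m : Matrix (Fin n) (Fin n) ℝ |
    ∃ g ∈ Matrix.orthogonalGroup (Fin n) ℝ, m = g * Matrix.diagonal d * gᵀ}
  have hsub : ∀ y ∈ permutohedron d, diagonal y ∈ O := by
    intro y hy
    have hmem : diagonal y ∈ diagonal '' permutohedron d := ⟨y, hy, rfl⟩
    rw [← hPi] at hmem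
    refine convexHull_mono ?_ hmem
    rintro _ ⟨σ, rfl⟩
    exact diagonal_comp_mem_orbit d σ⁻¹
  have hF : ∀ {e : Set (Fin n → ℝ)}, IsExtreme ℝ (permutohedron d) e → ∀ y ∈ e,
      diagonal y ∈ diagPart ⁻¹' (diagonal '' e) ∩ O := fun he y hy =>
    ⟨⟨y, hy, by simp [diagPart]⟩, hsub y (he.subset hy)⟩
  have hdiag : ∀ {e : Set (Fin n → ℝ)} {Y : Matrix (Fin n) (Fin n) ℝ},
      diagPart Y ∈ diagonal '' e → (fun i => Y i i) ∈ e := by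
    rintro e Y ⟨y, hy, hyY⟩
    rwa [← diagonal_injective hyY]
  obtain rfl | hne := g.eq_empty_or_nonempty
  · refine ⟨1, ?_⟩
    rw [Set.image_empty, Set.image_empty, Set.image_eq_empty]
    refine Set.eq_empty_of_forall_notMem fun y hy => ?_
    have hmem := hF hg' y hy
    rw [hconj] at hmem
    simp at hmem
  have hne' : g'.Nonempty := by
    obtain ⟨y, hy⟩ := hne
    have hmem := Set.mem_image_of_mem (fun Y => k * Y * kᵀ) (hF hg y hy)
    rw [← hconj] at hmem
    exact ⟨_, hdiag hmem.1⟩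
  have hb := orbitBarycenter_mem hgconv hg hne
  have hb' := orbitBarycenter_mem hg'conv hg' hne'
  set b := orbitBarycenter d g
  set b' := orbitBarycenter d g'
  have hnorm : ∀ c : Fin n → ℝ, (diagonal c * (diagonal c)ᵀ).trace = c ⬝ᵥ c := fun c => by
    simp [Matrix.trace, dotProduct]
  have hkbk : k * diagonal b * kᵀ = diagonal b' := by
    have hmem := Set.mem_image_of_mem (fun Y => k * Y * kᵀ) (hF hg b hb)
    rw [← hconj] at hmem
    have heq := trace_sub_diagonal_sq (orbitBarycenter_dotProduct hg'conv hg' (hdiag hmem.1))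
    have hmem' := hF hg' b' hb'
    rw [hconj] at hmem'
    obtain ⟨Y, hY, hYb'⟩ := hmem'
    have heq' := trace_sub_diagonal_sq (orbitBarycenter_dotProduct hgconv hg (hdiag hY.1))
    have hnn := trace_mul_transpose_self_nonneg (k * diagonal b * kᵀ - diagonal b')
    have hnn' := trace_mul_transpose_self_nonneg (Y - diagonal b)
    rw [trace_conj_mul_transpose hk, hnorm] at heq
    rw [← trace_conj_mul_transpose hk Y, show k * Y * kᵀ = diagonal b' from hYb', hnorm] at heq'
    refine sub_eq_zero.1 (eq_zero_of_trace_mul_transpose_self (le_antisymm ?_ hnn))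
    linarith
  obtain ⟨σ, hσ⟩ := exists_perm_of_conj_diagonal hk hkbk
  have hσ' : b ∘ ⇑σ⁻¹ = b' := by rw [← hσ]; ext i; simp
  have hsub1 : g ⊆ (fun y => y ∘ ⇑σ⁻¹) ⁻¹' g' :=
    subset_of_orbitBarycenter_mem hg hne (hg'conv.comp_preimage σ⁻¹) (hg'.comp_preimage σ⁻¹)
      (by rwa [Set.mem_preimage, hσ'])
  have hsub2 : g' ⊆ (fun y => y ∘ σ) ⁻¹' g :=
    subset_of_orbitBarycenter_mem hg' hne' (hgconv.comp_preimage σ) (hg.comp_preimage σ)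
      (by rwa [Set.mem_preimage, hσ])
  refine ⟨σ, ?_⟩
  have hact : ∀ y, permAct σ (diagonal y) = diagonal (y ∘ ⇑σ⁻¹) := fun y =>
    Matrix.submatrix_diagonal_equiv y σ⁻¹
  ext m
  constructor
  · rintro ⟨y, hy, rfl⟩
    refine ⟨diagonal (y ∘ σ), ⟨_, hsub2 hy, rfl⟩, ?_⟩
    rw [hact]
    congr 1
    ext i
    simp
  · rintro ⟨_, ⟨y, hy, rfl⟩, rfl⟩
    rw [hact]
    exact ⟨_, hsub1 hy, rfl⟩
end
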